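/- Let d ≥ 1 and let Ω ⊆ ℝ^d be a convex body. Then for every base point p ∈ int Ω, the volume entropy liminf_{R→∞} (1/R)·log Vol^B_{int Ω}(B_{int Ω}(p,R)) equals 2·a_f(Ω), twice the flag approximability of Ω. -/

import Mathlib

open Filter Set MeasureTheory Metric
open scoped ENNReal Topology Pointwise RealInnerProductSpace

noncomputable section
open scoped Classical

abbrev Euc (d : ℕ) := EuclideanSpace ℝ (Fin d)

/-- The Hilbert distance on a bounded open convex set `U`. -/
def hilbertDist {d : ℕ} (U : Set (Euc d)) (p q : Euc d) : ℝ :=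
  if p = q then 0
  else
    (1 / 2) * Real.log
      (((1 - sInf {t : ℝ | p + t • (q - p) ∈ U}) / (- sInf {t : ℝ | p + t • (q - p) ∈ U})) *
        (sSup {t : ℝ | p + t • (q - p) ∈ U} / (sSup {t : ℝ | p + t • (q - p) ∈ U} - 1)))

/-- The closed Hilbert ball. -/
def hilbertBall {d : ℕ} (U : Set (Euc d)) (p : Euc d) (R : ℝ) : Set (Euc d) :=
  {q ∈ U | hilbertDist U p q ≤ R}

/-- The Finsler (Hilbert) norm `F_U(p, v)`. -/
def finslerNorm {d : ℕ} (U : Set (Euc d)) (p v : Euc d) : ℝ :=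
  if v = 0 then 0
  else (1 / 2) * (1 / sSup {t : ℝ | 0 < t ∧ p + t • v ∈ U}
                + 1 / sSup {t : ℝ | 0 < t ∧ p - t • v ∈ U})

/-- The unit ball `β_U(p)` of the Finsler norm. -/
def finslerUnitBall {d : ℕ} (U : Set (Euc d)) (p : Euc d) : Set (Euc d) :=
  {v | finslerNorm U p v < 1}

/-- The Busemann volume of `A ⊆ U`. -/
def busemannVol {d : ℕ} (U : Set (Euc d)) (A : Set (Euc d)) : ℝ≥0∞ :=
  ∫⁻ p in A, volume (Metric.ball (0 : Euc d) 1) / volume (finslerUnitBall U p)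

/-- The polar body `K°`. -/
def polarSet {d : ℕ} (K : Set (Euc d)) : Set (Euc d) :=
  {y | ∀ v ∈ K, ⟪v, y⟫ ≤ (1 : ℝ)}

/-- The Holmes–Thompson volume of `A ⊆ U`. -/
def htVol {d : ℕ} (U : Set (Euc d)) (A : Set (Euc d)) : ℝ≥0∞ :=
  ∫⁻ p in A, volume (polarSet (finslerUnitBall U p)) / volume (Metric.ball (0 : Euc d) 1)

/-- The asymptotic ball `AsB_U(y, R)`. -/
def asympBall {d : ℕ} (U : Set (Euc d)) (y : Euc d) (R : ℝ) : Set (Euc d) :=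
  if 0 < R then (fun u => y + (1 - Real.exp (-2 * R)) • (u - y)) '' U else ∅

/-- `F` is a face of the compact convex set `P`. -/
def IsFace {d : ℕ} (P F : Set (Euc d)) : Prop :=
  F.Nonempty ∧ IsClosed F ∧ Convex ℝ F ∧ IsExtreme ℝ P F

/-- The dimension of a set: the dimension of its affine span. -/
def faceDim {d : ℕ} (F : Set (Euc d)) : ℕ :=
  Module.finrank ℝ (affineSpan ℝ F).direction

/-- The set of maximal flags of a `dm`-dimensional polytope `P ⊆ ℝ^d`. -/
def flagSet {d : ℕ} (dm : ℕ) (P : Set (Euc d)) : Set (Fin (dm + 1) → Set (Euc d)) :=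
  {f | (∀ i, IsFace P (f i) ∧ faceDim (f i) = (i : ℕ)) ∧
       ∀ i j : Fin (dm + 1), i ≤ j → f i ⊆ f j}

/-- `N(ε, Ω)`: the least number of maximal flags of a `d`-dimensional polytope within
Hausdorff distance `ε` of `Ω`. -/
def flagNumber (d : ℕ) (Ω : Set (Euc d)) (ε : ℝ) : ℕ :=
  sInf {n | ∃ V : Finset (Euc d), V.Nonempty ∧
    faceDim (convexHull ℝ (V : Set (Euc d))) = d ∧
    Metric.hausdorffDist (convexHull ℝ (V : Set (Euc d))) Ω ≤ ε ∧
    (flagSet d (convexHull ℝ (V : Set (Euc d)))).ncard = n}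

/-- The flag approximability `a_f(Ω)`. -/
def flagApprox (d : ℕ) (Ω : Set (Euc d)) : ℝ :=
  liminf (fun ε : ℝ => Real.log (flagNumber d Ω ε) / (- Real.log ε)) (𝓝[>] 0)

/-- `s` is a `dm`-simplex. -/
def IsSimplexSet {d : ℕ} (dm : ℕ) (s : Set (Euc d)) : Prop :=
  ∃ v : Fin (dm + 1) → Euc d, AffineIndependent ℝ v ∧ s = convexHull ℝ (Set.range v)

/-- `S` is a flag simplex of the `dm`-dimensional polytope `P`. -/
def IsFlagSimplex {d : ℕ} (dm : ℕ) (P S : Set (Euc d)) : Prop :=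
  ∃ f ∈ flagSet dm P, ∃ v : Fin (dm + 1) → Euc d, AffineIndependent ℝ v ∧
    S = convexHull ℝ (Set.range v) ∧ ∀ i, v i ∈ intrinsicInterior ℝ (f i)

/-- The Macbeath region `M'(x)`. -/
def macbeath {d : ℕ} (Ω : Set (Euc d)) (x : Euc d) : Set (Euc d) :=
  (fun v => x + v) ''
    (((5 : ℝ)⁻¹ • ((fun w => w - x) '' Ω)) ∩ ((5 : ℝ)⁻¹ • ((fun w => x - w) '' Ω)))

/-- The Funk distance with respect to the convex body `Ω`. -/
def funkDist {d : ℕ} (Ω : Set (Euc d)) (p q : Euc d) : ℝ :=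
  if p = q then 0
  else Real.log (sSup {t : ℝ | p + t • (q - p) ∈ Ω} /
        (sSup {t : ℝ | p + t • (q - p) ∈ Ω} - 1))

/-- The symmetric (unscaled) Macbeath region at `x`, centered at the origin. -/
def Mac {d : ℕ} (Ω : Set (Euc d)) (x : Euc d) : Set (Euc d) := {z | x + z ∈ Ω ∧ x - z ∈ Ω}

section MacBasics
variable {d : ℕ} {Ω : Set (Euc d)}

lemma mac_convex (hc : Convex ℝ Ω) (x : Euc d) : Convex ℝ (Mac Ω x) := by
  intro a ha b hb s t hs ht hst
  refine ⟨?_, ?_⟩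
  · have := hc ha.1 hb.1 hs ht hst
    convert this using 1
    rw [show s = 1 - t by linarith]; module
  · have := hc ha.2 hb.2 hs ht hst
    convert this using 1
    rw [show s = 1 - t by linarith]; module

lemma mac_neg {x z : Euc d} (h : z ∈ Mac Ω x) : -z ∈ Mac Ω x := by
  refine ⟨?_, ?_⟩
  · simpa [sub_eq_add_neg] using h.2
  · simpa [sub_eq_add_neg] using h.1

lemma mac_smul (hc : Convex ℝ Ω) {x z : Euc d} (h : z ∈ Mac Ω x) {s : ℝ} (h0 : -1 ≤ s)
    (h1 : s ≤ 1) : s • z ∈ Mac Ω x := by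
  have := mac_convex hc x h (mac_neg h) (a := (1 + s) / 2) (b := (1 - s) / 2)
    (by linarith) (by linarith) (by ring)
  convert this using 1
  module

lemma mac_isClosed (hcl : IsClosed Ω) (x : Euc d) : IsClosed (Mac Ω x) := by
  apply IsClosed.inter
  · exact hcl.preimage (continuous_const.add continuous_id)
  · exact hcl.preimage (continuous_const.sub continuous_id)

lemma mac_isCompact (hcomp : IsCompact Ω) (x : Euc d) : IsCompact (Mac Ω x) := by
  have h1 : Mac Ω x ⊆ (fun y => y - x) '' Ω := by
    intro z hz
    exact ⟨x + z, hz.1, by simp⟩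
  exact (hcomp.image (by fun_prop)).of_isClosed_subset (mac_isClosed hcomp.isClosed x) h1

lemma mac_measurable (hcomp : IsCompact Ω) (x : Euc d) : MeasurableSet (Mac Ω x) :=
  (mac_isClosed hcomp.isClosed x).measurableSet

lemma mac_volume_lt_top (hcomp : IsCompact Ω) (x : Euc d) : volume (Mac Ω x) < ⊤ :=
  (mac_isCompact hcomp x).measure_lt_top

lemma mac_ball {x : Euc d} {ρ : ℝ} (h : ball x ρ ⊆ Ω) : ball 0 ρ ⊆ Mac Ω x := by
  intro z hz
  rw [mem_ball_zero_iff] at hz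
  exact ⟨h (by simpa [mem_ball, dist_eq_norm] using hz), h (by simpa [mem_ball, dist_eq_norm] using hz)⟩

lemma mac_smul_mono (hc : Convex ℝ Ω) {x : Euc d} {s t : ℝ} (hs : 0 ≤ s) (hst : s ≤ t) :
    s • Mac Ω x ⊆ t • Mac Ω x := by
  rcases eq_or_lt_of_le (hs.trans hst) with h | h
  · have : s = t := by linarith
    rw [this]
  · rintro _ ⟨z, hz, rfl⟩
    refine ⟨(s / t) • z, mac_smul hc hz ?_ ?_, ?_⟩
    · have : 0 ≤ s / t := by positivity
      linarith
    · rw [div_le_one h]; exact hst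
    · simp only [smul_smul]
      congr 1; field_simp

lemma mac_smul_neg {x z : Euc d} {s : ℝ} (h : z ∈ s • Mac Ω x) : -z ∈ s • Mac Ω x := by
  obtain ⟨a, ha, rfl⟩ := h
  exact ⟨-a, mac_neg ha, by simp⟩

lemma mac_smul_add (hc : Convex ℝ Ω) {x a b : Euc d} {s t : ℝ} (hs : 0 ≤ s) (ht : 0 ≤ t)
    (ha : a ∈ s • Mac Ω x) (hb : b ∈ t • Mac Ω x) : a + b ∈ (s + t) • Mac Ω x := by
  rw [(mac_convex hc x).add_smul hs ht]
  exact add_mem_add ha hb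

lemma mac_smul_smul {x : Euc d} {s t : ℝ} {B : Set (Euc d)} (h : B ⊆ t • Mac Ω x) :
    s • B ⊆ (s * t) • Mac Ω x := by
  rw [← smul_smul]
  exact smul_set_mono h

lemma mac_lip (hc : Convex ℝ Ω) {x y : Euc d} {t : ℝ} (h0 : 0 ≤ t) (h1 : t ≤ 1)
    (h : y - x ∈ t • Mac Ω x) : (1 - t) • Mac Ω x ⊆ Mac Ω y := by
  obtain ⟨a, ha, hax⟩ := h
  have hy : y = x + t • a := by
    have : t • a = y - x := hax
    rw [this]; abel
  rintro _ ⟨z, hz, rfl⟩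
  refine ⟨?_, ?_⟩
  · have := hc ha.1 hz.1 h0 (b := 1 - t) (by linarith) (by ring)
    convert this using 1
    rw [hy]; module
  · have := hc ha.1 hz.2 h0 (b := 1 - t) (by linarith) (by ring)
    convert this using 1
    rw [hy]; module

lemma mac_sub_mem (hc : Convex ℝ Ω) {x y : Euc d} {t : ℝ} (h0 : 0 ≤ t) (h1 : t ≤ 1 / 3)
    (h : y - x ∈ t • Mac Ω x) : x - y ∈ (3 / 2 * t) • Mac Ω y := by
  have h2 := mac_lip hc h0 (by linarith) h
  have h3 : x - y ∈ t • Mac Ω x := by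
    have := mac_smul_neg h
    simpa using this
  obtain ⟨a, ha, hax⟩ := h3
  have h4 : (1 - t) • a ∈ Mac Ω y := h2 ⟨a, ha, rfl⟩
  have h5 : x - y ∈ (t / (1 - t)) • Mac Ω y := by
    refine ⟨_, h4, ?_⟩
    simp only [smul_smul]
    rw [← hax]
    simp only
    congr 1
    have : 1 - t ≠ 0 := by linarith
    field_simp
  refine mac_smul_mono hc (by apply div_nonneg <;> linarith) ?_ h5
  rw [div_le_iff₀ (by linarith)]
  nlinarith

lemma mac_sub_two (hc : Convex ℝ Ω) {x y : Euc d} {t : ℝ} (h0 : 0 ≤ t) (h1 : t ≤ 1 / 3)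
    (h : y - x ∈ t • Mac Ω x) : Mac Ω y ⊆ (2 : ℝ) • Mac Ω x := by
  have h2 := mac_sub_mem hc h0 h1 h
  have h3 := mac_lip hc (by linarith) (by linarith) h2
  intro z hz
  have h4 : (2 : ℝ)⁻¹ • z ∈ Mac Ω x := by
    apply h3
    exact mac_smul_mono hc (s := (2 : ℝ)⁻¹) (by norm_num) (by linarith) ⟨z, hz, rfl⟩
  exact ⟨_, h4, by simp [smul_smul]⟩

/-- depth of a point -/
def dep (Ω : Set (Euc d)) (x : Euc d) : ℝ := infDist x Ωᶜ

lemma compl_nonempty_of_compact (hd : 1 ≤ d) (hcomp : IsCompact Ω) : (Ωᶜ).Nonempty := by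
  have : Nonempty (Fin d) := ⟨⟨0, hd⟩⟩
  rw [nonempty_compl]
  intro h
  rw [h] at hcomp
  exact noncompact_univ _ hcomp

lemma le_dep (hd : 1 ≤ d) (hcomp : IsCompact Ω) {x : Euc d} {ρ : ℝ} (h : ball x ρ ⊆ Ω) :
    ρ ≤ dep Ω x := by
  unfold dep
  rw [le_infDist (compl_nonempty_of_compact hd hcomp)]
  intro y hy
  by_contra hlt
  push Not at hlt
  exact hy (h (by rwa [mem_ball, dist_comm]))

lemma dep_ball (x : Euc d) : ball x (dep Ω x) ⊆ Ω := ball_infDist_compl_subset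

lemma dep_nonneg (x : Euc d) : 0 ≤ dep Ω x := infDist_nonneg

lemma dep_closedBall (hcl : IsClosed Ω) {x : Euc d} (h : 0 < dep Ω x) :
    closedBall x (dep Ω x) ⊆ Ω := by
  rw [← closure_ball x h.ne']
  exact hcl.closure_subset_iff.2 (dep_ball x)

lemma dep_pos {x : Euc d} (hd : 1 ≤ d) (hcomp : IsCompact Ω) (hx : x ∈ interior Ω) :
    0 < dep Ω x := by
  obtain ⟨r, hr, h⟩ := Metric.isOpen_iff.1 isOpen_interior x hx
  exact lt_of_lt_of_le hr (le_dep hd hcomp (h.trans interior_subset))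

lemma mem_interior_of_dep {x : Euc d} (h : 0 < dep Ω x) : x ∈ interior Ω := by
  rw [mem_interior]
  exact ⟨_, dep_ball x, isOpen_ball, mem_ball_self h⟩

/-- convex combination of a ball and a point -/
lemma ball_combo (hc : Convex ℝ Ω) {x y : Euc d} {ρ t : ℝ} (hρ : ball x ρ ⊆ Ω) (hy : y ∈ Ω)
    (h0 : 0 ≤ t) (h1 : t < 1) : ball (t • y + (1 - t) • x) ((1 - t) * ρ) ⊆ Ω := by
  intro q hq
  have ht : 0 < 1 - t := by linarith
  have hq' : x + (1 - t)⁻¹ • (q - (t • y + (1 - t) • x)) ∈ Ω := by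
    apply hρ
    rw [mem_ball, dist_eq_norm] at hq ⊢
    rw [add_sub_cancel_left, norm_smul, Real.norm_of_nonneg (by positivity)]
    rw [inv_mul_lt_iff₀ ht]
    exact hq
  have := hc hy hq' h0 ht.le (by ring)
  convert this using 1
  rw [smul_add, smul_smul, mul_inv_cancel₀ ht.ne']
  module

lemma dep_lip (hd : 1 ≤ d) (hcomp : IsCompact Ω) (hc : Convex ℝ Ω) {x y : Euc d} {t : ℝ}
    (h0 : 0 ≤ t) (h1 : t < 1)
    (h : y - x ∈ t • Mac Ω x) : (1 - t) * dep Ω x ≤ dep Ω y := by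
  obtain ⟨a, ha, hax⟩ := h
  have hy : y = x + t • a := by
    have : t • a = y - x := hax
    rw [this]; abel
  apply le_dep hd hcomp
  have := ball_combo hc (dep_ball x) ha.1 h0 h1
  convert this using 2
  rw [hy]; module

lemma dep_mid (hd : 1 ≤ d) (hcomp : IsCompact Ω) (hc : Convex ℝ Ω) {v w : Euc d}
    (hv : 0 < dep Ω v) (hw : 0 < dep Ω w) :
    dep Ω v * dep Ω w ≤ dep Ω ((1 / 2 : ℝ) • (v + w)) ^ 2 := by
  have key : (dep Ω v + dep Ω w) / 2 ≤ dep Ω ((1 / 2 : ℝ) • (v + w)) := by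
    apply le_dep hd hcomp
    intro q hq
    set z := q - (1 / 2 : ℝ) • (v + w) with hz
    rw [mem_ball, dist_eq_norm] at hq
    set s := dep Ω v + dep Ω w
    have hs : 0 < s := by positivity
    have h1 : v + (2 * dep Ω v / s) • z ∈ Ω := by
      apply dep_ball v
      rw [mem_ball, dist_eq_norm, add_sub_cancel_left, norm_smul, Real.norm_of_nonneg (by positivity)]
      calc 2 * dep Ω v / s * ‖z‖ < 2 * dep Ω v / s * (s / 2) := by gcongr
        _ = dep Ω v := by field_simp
    have h2 : w + (2 * dep Ω w / s) • z ∈ Ω := by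
      apply dep_ball w
      rw [mem_ball, dist_eq_norm, add_sub_cancel_left, norm_smul, Real.norm_of_nonneg (by positivity)]
      calc 2 * dep Ω w / s * ‖z‖ < 2 * dep Ω w / s * (s / 2) := by gcongr
        _ = dep Ω w := by field_simp
    have := hc h1 h2 (a := 1 / 2) (b := 1 / 2) (by norm_num) (by norm_num) (by norm_num)
    convert this using 1
    have e : (1 / 2 : ℝ) * (2 * dep Ω v / s) + (1 / 2 : ℝ) * (2 * dep Ω w / s) = 1 := by
      field_simp; rfl
    have e2 : q = (1 / 2 : ℝ) • (v + w) + ((1 / 2 : ℝ) * (2 * dep Ω v / s) + (1 / 2 : ℝ) * (2 * dep Ω w / s)) • z := by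
      rw [e, one_smul, hz]; abel
    rw [e2]
    module
  have h3 := pow_le_pow_left₀ (by positivity) key 2
  nlinarith [sq_nonneg (dep Ω v - dep Ω w)]

/-- real valued volume of the Macbeath region -/
def mvol (Ω : Set (Euc d)) (x : Euc d) : ℝ := (volume (Mac Ω x)).toReal

lemma vol_smul_real (s : ℝ) (hs : 0 ≤ s) (A : Set (Euc d)) :
    (volume (s • A)).toReal = s ^ d * (volume A).toReal := by
  rw [Measure.addHaar_smul]
  simp [abs_of_nonneg (pow_nonneg hs d), ENNReal.toReal_mul, pow_nonneg hs d]

lemma mvol_lip (hcomp : IsCompact Ω) (hc : Convex ℝ Ω) {x y : Euc d} {t : ℝ}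
    (h0 : 0 ≤ t) (h1 : t ≤ 1)
    (h : y - x ∈ t • Mac Ω x) : (1 - t) ^ d * mvol Ω x ≤ mvol Ω y := by
  unfold mvol
  rw [← vol_smul_real _ (by linarith)]
  exact ENNReal.toReal_mono (mac_volume_lt_top hcomp y).ne (measure_mono (mac_lip hc h0 h1 h))

lemma mvol_nonneg (x : Euc d) : 0 ≤ mvol Ω x := ENNReal.toReal_nonneg

lemma mvol_le (hcomp : IsCompact Ω) (x : Euc d) : mvol Ω x ≤ (volume Ω).toReal := by
  unfold mvol
  apply ENNReal.toReal_mono hcomp.measure_lt_top.ne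
  calc volume (Mac Ω x) ≤ volume ((fun z => x + z) ⁻¹' Ω) := measure_mono fun z hz => hz.1
    _ = volume Ω := measure_preimage_add _ _ _

lemma le_mvol (hd : 1 ≤ d) (hcomp : IsCompact Ω) (x : Euc d) :
    dep Ω x ^ d * (volume (ball (0 : Euc d) 1)).toReal ≤ mvol Ω x := by
  unfold mvol
  have h := mac_ball (dep_ball (Ω := Ω) x)
  rcases eq_or_lt_of_le (dep_nonneg (Ω := Ω) x) with h0 | h0
  · rw [← h0, zero_pow (by omega), zero_mul]; exact ENNReal.toReal_nonneg
  · rw [← vol_smul_real _ h0.le, _root_.smul_ball h0.ne']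
    simp only [smul_zero, Real.norm_of_nonneg h0.le, mul_one]
    exact ENNReal.toReal_mono (mac_volume_lt_top hcomp x).ne (measure_mono h)

end MacBasics


section HilbertBasics
variable {d : ℕ} {Ω : Set (Euc d)}

lemma seg_bddAbove (hcomp : IsCompact Ω) (x : Euc d) {v : Euc d} (hv : v ≠ 0) :
    ∃ M : ℝ, ∀ t : ℝ, x + t • v ∈ interior Ω → |t| ≤ M := by
  obtain ⟨M, hM⟩ := hcomp.isBounded.exists_norm_le
  refine ⟨(M + ‖x‖) / ‖v‖, fun t ht => ?_⟩
  have hv' : 0 < ‖v‖ := norm_pos_iff.2 hv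
  rw [le_div_iff₀ hv']
  have h1 := hM _ (interior_subset ht)
  have h2 : ‖t • v‖ ≤ ‖x + t • v‖ + ‖x‖ := by
    have : t • v = (x + t • v) - x := by abel
    calc ‖t • v‖ = ‖(x + t • v) - x‖ := by rw [← this]
      _ ≤ _ := norm_sub_le _ _
  rw [norm_smul, Real.norm_eq_abs] at h2
  linarith

lemma seg_interior (hc : Convex ℝ Ω) {x v : Euc d} (hx : x ∈ interior Ω) {a t : ℝ}
    (ha : x + a • v ∈ Ω) (h0 : 0 ≤ t) (hta : t < a) : x + t • v ∈ interior Ω := by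
  have ha0 : 0 < a := by linarith
  have := hc.combo_interior_self_mem_interior hx ha (a := 1 - t / a) (b := t / a)
    (by rw [sub_pos, div_lt_one ha0]; exact hta) (by positivity) (by ring)
  convert this using 1
  rw [smul_add, smul_smul, div_mul_cancel₀ _ ha0.ne']
  module

lemma le_sSup_seg (hcomp : IsCompact Ω) (hc : Convex ℝ Ω) {x v : Euc d} (hx : x ∈ interior Ω)
    (hv : v ≠ 0) {a : ℝ} (ha0 : 0 < a) (ha : x + a • v ∈ Ω) :
    a ≤ sSup {t : ℝ | 0 < t ∧ x + t • v ∈ interior Ω} := by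
  obtain ⟨M, hM⟩ := seg_bddAbove hcomp x hv
  refine le_of_forall_lt_imp_le_of_dense fun t ht => ?_
  have h1 : max t (a / 2) < a := max_lt ht (by linarith)
  have h2 : 0 < max t (a / 2) := lt_max_of_lt_right (by linarith)
  refine (le_max_left t (a / 2)).trans ?_
  exact le_csSup ⟨M, fun s hs => (le_abs_self s).trans (hM s hs.2)⟩
    ⟨h2, seg_interior hc hx ha h2.le h1⟩

lemma mem_of_lt_sSup (hc : Convex ℝ Ω) {x v : Euc d} (hx : x ∈ interior Ω) {a : ℝ} (ha0 : 0 < a)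
    (ha : a < sSup {t : ℝ | 0 < t ∧ x + t • v ∈ interior Ω}) : x + a • v ∈ Ω := by
  have hne : {t : ℝ | 0 < t ∧ x + t • v ∈ interior Ω}.Nonempty := by
    by_contra h
    rw [not_nonempty_iff_eq_empty] at h
    rw [h, Real.sSup_empty] at ha
    linarith
  obtain ⟨t, ht, hat⟩ := exists_lt_of_lt_csSup hne ha
  exact interior_subset (seg_interior hc hx (interior_subset ht.2) ha0.le hat)

lemma half_mac_sub_finsler (hcomp : IsCompact Ω) (hc : Convex ℝ Ω) {x : Euc d}
    (hx : x ∈ interior Ω) : (1 / 2 : ℝ) • Mac Ω x ⊆ finslerUnitBall (interior Ω) x := by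
  rintro _ ⟨z, hz, rfl⟩
  change finslerNorm _ _ _ < 1
  unfold finslerNorm
  split_ifs with h
  · norm_num
  have h1 := le_sSup_seg hcomp hc hx h (a := 2) (by norm_num)
    (by simp only [smul_smul]; norm_num; exact hz.1)
  have h2 := le_sSup_seg hcomp hc hx (neg_ne_zero.2 h) (a := 2) (by norm_num)
    (by simp only [smul_neg, smul_smul]; norm_num; rw [← sub_eq_add_neg]; exact hz.2)
  simp only [smul_neg, ← sub_eq_add_neg] at h2
  set A := sSup {t : ℝ | 0 < t ∧ x + t • (fun x => (1 / 2 : ℝ) • x) z ∈ interior Ω}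
  set B := sSup {t : ℝ | 0 < t ∧ x - t • (fun x => (1 / 2 : ℝ) • x) z ∈ interior Ω}
  have h3 : 1 / A ≤ 1 / 2 := one_div_le_one_div_of_le (by norm_num) h1
  have h4 : 1 / B ≤ 1 / 2 := one_div_le_one_div_of_le (by norm_num) h2
  linarith

lemma finsler_sub_two_mac (hcomp : IsCompact Ω) (hc : Convex ℝ Ω) {x : Euc d}
    (hx : x ∈ interior Ω) : finslerUnitBall (interior Ω) x ⊆ (2 : ℝ) • Mac Ω x := by
  intro v hv
  by_cases h : v = 0
  · subst h
    exact ⟨0, ⟨by simpa using interior_subset hx, by simpa using interior_subset hx⟩, by simp⟩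
  change finslerNorm _ _ _ < 1 at hv
  unfold finslerNorm at hv
  rw [if_neg h] at hv
  obtain ⟨r, hr, hball⟩ := Metric.isOpen_iff.1 isOpen_interior x hx
  have hpos : ∀ v : Euc d, v ≠ 0 → 0 < sSup {t : ℝ | 0 < t ∧ x + t • v ∈ interior Ω} := by
    intro v hv
    have hv' : 0 < ‖v‖ := norm_pos_iff.2 hv
    have ha : 0 < r / 2 / ‖v‖ := by positivity
    refine lt_of_lt_of_le ha (le_sSup_seg hcomp hc hx hv ha (interior_subset (hball ?_)))
    rw [mem_ball, dist_eq_norm, add_sub_cancel_left, norm_smul, Real.norm_of_nonneg ha.le,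
      div_mul_cancel₀ _ hv'.ne']
    linarith
  have hA := hpos v h
  have hB := hpos (-v) (neg_ne_zero.2 h)
  have hBe : sSup {t : ℝ | 0 < t ∧ x - t • v ∈ interior Ω}
      = sSup {t : ℝ | 0 < t ∧ x + t • (-v) ∈ interior Ω} := by
    simp only [smul_neg, ← sub_eq_add_neg]
  rw [hBe] at hv
  set A := sSup {t : ℝ | 0 < t ∧ x + t • v ∈ interior Ω} with hAd
  set B := sSup {t : ℝ | 0 < t ∧ x + t • (-v) ∈ interior Ω} with hBd
  have hA1 : 0 < 1 / A := by positivity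
  have hB1 : 0 < 1 / B := by positivity
  have hA2 : 1 / 2 < A := by
    have : 1 / A < 2 := by linarith
    rw [div_lt_iff₀ hA] at this
    linarith
  have hB2 : 1 / 2 < B := by
    have : 1 / B < 2 := by linarith
    rw [div_lt_iff₀ hB] at this
    linarith
  refine ⟨(1 / 2 : ℝ) • v, ⟨mem_of_lt_sSup hc hx (by norm_num) hA2, ?_⟩, by simp [smul_smul]⟩
  have := mem_of_lt_sSup hc hx (by norm_num) hB2
  rwa [smul_neg, ← sub_eq_add_neg] at this

/-- The Busemann density. -/
def bdens (U : Set (Euc d)) (x : Euc d) : ℝ≥0∞ :=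
  volume (Metric.ball (0 : Euc d) 1) / volume (finslerUnitBall U x)

lemma bdens_le (hcomp : IsCompact Ω) (hc : Convex ℝ Ω) {x : Euc d} (hx : x ∈ interior Ω) :
    bdens (interior Ω) x ≤ volume (Metric.ball (0 : Euc d) 1) / volume ((1 / 2 : ℝ) • Mac Ω x) := by
  unfold bdens
  gcongr
  exact half_mac_sub_finsler hcomp hc hx

lemma le_bdens (hcomp : IsCompact Ω) (hc : Convex ℝ Ω) {x : Euc d} (hx : x ∈ interior Ω) :
    volume (Metric.ball (0 : Euc d) 1) / volume ((2 : ℝ) • Mac Ω x) ≤ bdens (interior Ω) x := by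
  unfold bdens
  gcongr
  exact finsler_sub_two_mac hcomp hc hx

lemma le_sSup_seg' (hcomp : IsCompact Ω) (hc : Convex ℝ Ω) {x v : Euc d} (hx : x ∈ interior Ω)
    (hv : v ≠ 0) {a : ℝ} (ha0 : 0 < a) (ha : x + a • v ∈ Ω) :
    a ≤ sSup {t : ℝ | x + t • v ∈ interior Ω} := by
  obtain ⟨M, hM⟩ := seg_bddAbove hcomp x hv
  refine le_of_forall_lt_imp_le_of_dense fun t ht => ?_
  have h1 : max t (a / 2) < a := max_lt ht (by linarith)
  have h2 : 0 < max t (a / 2) := lt_max_of_lt_right (by linarith)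
  refine (le_max_left t (a / 2)).trans ?_
  exact le_csSup ⟨M, fun s hs => (le_abs_self s).trans (hM s hs)⟩
    (seg_interior hc hx ha h2.le h1)

lemma sInf_seg (x v : Euc d) (S : Set (Euc d)) : - sInf {t : ℝ | x + t • v ∈ S}
    = sSup {t : ℝ | x + t • (-v) ∈ S} := by
  rw [Real.sInf_def, neg_neg]
  congr 1
  ext t
  simp

lemma sSup_seg_mem (hcomp : IsCompact Ω) {x v : Euc d} (hx : x ∈ interior Ω)
    (hv : v ≠ 0) : x + (sSup {t : ℝ | x + t • v ∈ interior Ω}) • v ∈ Ω := by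
  obtain ⟨M, hM⟩ := seg_bddAbove hcomp x hv
  have h1 : sSup {t : ℝ | x + t • v ∈ interior Ω} ∈ closure {t : ℝ | x + t • v ∈ interior Ω} :=
    csSup_mem_closure ⟨0, by simpa using hx⟩ ⟨M, fun s hs => (le_abs_self s).trans (hM s hs)⟩
  have h2 : IsClosed {t : ℝ | x + t • v ∈ Ω} :=
    hcomp.isClosed.preimage (by fun_prop)
  have h3 : {t : ℝ | x + t • v ∈ interior Ω} ⊆ {t : ℝ | x + t • v ∈ Ω} :=
    fun t ht => interior_subset (s := Ω) ht
  exact h2.closure_subset_iff.2 h3 h1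

lemma hilbert_deep (hcomp : IsCompact Ω) (hc : Convex ℝ Ω) {p x : Euc d} {r R : ℝ} (hr : 0 < r)
    (hp : ball p r ⊆ Ω) (hR : 0 ≤ R) (hx : x ∈ hilbertBall (interior Ω) p R) :
    ball x (Real.exp (-2 * R) * r) ⊆ Ω := by
  have hpi : p ∈ interior Ω := mem_interior.2 ⟨_, hp, isOpen_ball, mem_ball_self hr⟩
  obtain ⟨hxU, hxd⟩ := hx
  have hexp : Real.exp (-2 * R) ≤ 1 := Real.exp_le_one_iff.2 (by linarith)
  by_cases hpx : p = x
  · subst hpx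
    refine (ball_subset_ball ?_).trans hp
    nlinarith
  unfold hilbertDist at hxd
  rw [if_neg hpx] at hxd
  have hv : x - p ≠ 0 := sub_ne_zero.2 (Ne.symm hpx)
  set b := sSup {t : ℝ | p + t • (x - p) ∈ interior Ω} with hb
  set a := sInf {t : ℝ | p + t • (x - p) ∈ interior Ω} with ha
  have hbm := sSup_seg_mem hcomp hpi hv
  rw [← hb] at hbm
  obtain ⟨M, hM⟩ := seg_bddAbove hcomp p hv
  have hb1 : 1 < b := by
    have hop : IsOpen {t : ℝ | p + t • (x - p) ∈ interior Ω} :=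
      isOpen_interior.preimage (by fun_prop)
    obtain ⟨e, he, hsub⟩ := Metric.isOpen_iff.1 hop 1 (by simpa using hxU)
    have : (1 + e / 2) ∈ {t : ℝ | p + t • (x - p) ∈ interior Ω} := by
      apply hsub
      rw [mem_ball, Real.dist_eq]
      rw [add_sub_cancel_left, abs_of_pos (by linarith)]
      linarith
    have h2 := le_csSup (⟨M, fun s hs => (le_abs_self s).trans (hM s hs)⟩ : BddAbove {t : ℝ | p + t • (x - p) ∈ interior Ω}) this
    linarith
  have ha1 : 0 < - a := by
    rw [ha, sInf_seg]
    have hv' : 0 < ‖x - p‖ := norm_pos_iff.2 hv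
    have hapos : 0 < r / 2 / ‖x - p‖ := by positivity
    refine lt_of_lt_of_le hapos (le_sSup_seg' hcomp hc hpi (neg_ne_zero.2 hv) hapos (hp ?_))
    rw [mem_ball, dist_eq_norm, add_sub_cancel_left, norm_smul, Real.norm_of_nonneg hapos.le,
      norm_neg, div_mul_cancel₀ _ hv'.ne']
    linarith
  have hf1 : 1 ≤ (1 - a) / (-a) := by
    rw [le_div_iff₀ ha1]; linarith
  have hf2 : 0 < b / (b - 1) := div_pos (by linarith) (by linarith)
  have hle : b / (b - 1) ≤ Real.exp (2 * R) := by
    rw [← Real.log_le_iff_le_exp hf2]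
    have : Real.log (b / (b - 1)) ≤ Real.log ((1 - a) / (-a) * (b / (b - 1))) := by
      apply Real.log_le_log hf2
      nlinarith
    linarith
  have hkey : Real.exp (-2 * R) ≤ 1 - 1 / b := by
    have e1 : 1 - 1 / b = (b / (b - 1))⁻¹ := by
      have : b - 1 ≠ 0 := by linarith
      have : b ≠ 0 := by linarith
      field_simp
    rw [e1, show -2 * R = -(2 * R) by ring, Real.exp_neg]
    exact inv_anti₀ hf2 hle
  have hb0 : 0 < 1 / b := by positivity
  have := ball_combo hc hp hbm (t := 1 / b) hb0.le
    (by rw [div_lt_one (by linarith)]; exact hb1)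
  have e2 : (1 / b) • (p + b • (x - p)) + (1 - 1 / b) • p = x := by
    rw [smul_add, smul_smul, one_div_mul_cancel (by linarith)]
    module
  rw [e2] at this
  refine (ball_subset_ball ?_).trans this
  gcongr

lemma deep_hilbert (hcomp : IsCompact Ω) (hc : Convex ℝ Ω) {p x : Euc d} {r ρ Λ : ℝ} (hr : 0 < r)
    (hp : ball p r ⊆ Ω) (hΛ : Ω ⊆ closedBall p Λ) (hρ : 0 < ρ) (hx : ball x ρ ⊆ Ω) :
    hilbertDist (interior Ω) p x ≤ (1 / 2) * Real.log ((1 + 2 * Λ / r) * (1 + 2 * Λ / ρ)) := by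
  have hpi : p ∈ interior Ω := mem_interior.2 ⟨_, hp, isOpen_ball, mem_ball_self hr⟩
  have hxΩ : x ∈ Ω := hx (mem_ball_self hρ)
  have hxp : ‖x - p‖ ≤ Λ := by simpa [dist_eq_norm] using hΛ hxΩ
  have hΛ0 : 0 ≤ Λ := (norm_nonneg _).trans hxp
  unfold hilbertDist
  split_ifs with hpx
  · apply mul_nonneg (by norm_num)
    apply Real.log_nonneg
    have h1 : 0 ≤ 2 * Λ / r := by positivity
    have h2 : 0 ≤ 2 * Λ / ρ := by positivity
    nlinarith [mul_nonneg h1 h2]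
  have hv : x - p ≠ 0 := sub_ne_zero.2 (Ne.symm hpx)
  have hv' : 0 < ‖x - p‖ := norm_pos_iff.2 hv
  have hΛp : 0 < Λ := by linarith
  have ha1 : r / 2 / ‖x - p‖ ≤ - sInf {t : ℝ | p + t • (x - p) ∈ interior Ω} := by
    rw [sInf_seg]
    have hapos : 0 < r / 2 / ‖x - p‖ := by positivity
    refine (le_sSup_seg' hcomp hc hpi (neg_ne_zero.2 hv) hapos (hp ?_))
    rw [mem_ball, dist_eq_norm, add_sub_cancel_left, norm_smul, Real.norm_of_nonneg hapos.le,
      norm_neg, div_mul_cancel₀ _ hv'.ne']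
    linarith
  have hb1 : 1 + ρ / 2 / ‖x - p‖ ≤ sSup {t : ℝ | p + t • (x - p) ∈ interior Ω} := by
    have hapos : 0 < ρ / 2 / ‖x - p‖ := by positivity
    refine (le_sSup_seg' hcomp hc hpi hv (by linarith) (hx ?_))
    have e : p + (1 + ρ / 2 / ‖x - p‖) • (x - p) - x = (ρ / 2 / ‖x - p‖) • (x - p) := by module
    rw [mem_ball, dist_eq_norm, e, norm_smul, Real.norm_of_nonneg hapos.le,
      div_mul_cancel₀ _ hv'.ne']
    linarith
  set b := sSup {t : ℝ | p + t • (x - p) ∈ interior Ω}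
  set a := sInf {t : ℝ | p + t • (x - p) ∈ interior Ω}
  have hra : r / 2 / Λ ≤ -a := le_trans (by gcongr) ha1
  have hrb : ρ / 2 / Λ ≤ b - 1 := le_trans (by gcongr) (by linarith : ρ / 2 / ‖x - p‖ ≤ b - 1)
  have hra0 : 0 < r / 2 / Λ := by positivity
  have hrb0 : 0 < ρ / 2 / Λ := by positivity
  have f1 : (1 - a) / (-a) ≤ 1 + 2 * Λ / r := by
    have : (1 - a) / (-a) = 1 + 1 / (-a) := by
      have : a ≠ 0 := by linarith
      field_simp; ring
    rw [this]
    have h3 : 1 / (-a) ≤ 1 / (r / 2 / Λ) := one_div_le_one_div_of_le hra0 hra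
    have h4 : 1 / (r / 2 / Λ) = 2 * Λ / r := by field_simp
    linarith
  have f2 : b / (b - 1) ≤ 1 + 2 * Λ / ρ := by
    have : b / (b - 1) = 1 + 1 / (b - 1) := by
      have : b - 1 ≠ 0 := by linarith
      field_simp; ring
    rw [this]
    have h3 : 1 / (b - 1) ≤ 1 / (ρ / 2 / Λ) := one_div_le_one_div_of_le hrb0 hrb
    have h4 : 1 / (ρ / 2 / Λ) = 2 * Λ / ρ := by field_simp
    linarith
  have g1 : 0 < (1 - a) / (-a) := div_pos (by linarith) (by linarith)
  have g2 : 0 < b / (b - 1) := div_pos (by linarith) (by linarith)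
  gcongr

end HilbertBasics


section Packing
variable {d : ℕ} {Ω : Set (Euc d)}

lemma smul_mac_measurable (hcomp : IsCompact Ω) (x : Euc d) (s : ℝ) :
    MeasurableSet (s • Mac Ω x) :=
  ((mac_isCompact hcomp x).smul s).isClosed.measurableSet

lemma mem_smul_mac_of_smul (x : Euc d) {b : Euc d} {c s : ℝ} (hc : c ≠ 0)
    (h : c • b ∈ s • Mac Ω x) : b ∈ (s / c) • Mac Ω x := by
  obtain ⟨a, ha, hab⟩ := h
  refine ⟨a, ha, ?_⟩
  simp only at hab ⊢
  rw [div_eq_inv_mul, ← smul_smul, hab, smul_smul, inv_mul_cancel₀ hc, one_smul]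

lemma translates_le (hcomp : IsCompact Ω) (hc : Convex ℝ Ω) {x b : Euc d} {s : ℝ} (hs : 0 < s)
    (J : ℕ) (hJ : 0 < J) (hb : b ∉ (2 * s * J) • Mac Ω x) {E : Set (Euc d)}
    (hE : ∀ k : ℕ, k < J → ∀ z ∈ s • Mac Ω x, ((k : ℝ) / J) • b + z ∈ E) :
    (J : ℝ≥0∞) * volume (s • Mac Ω x) ≤ volume E := by
  have hJ' : (0 : ℝ) < J := by exact_mod_cast hJ
  let S : ℕ → Set (Euc d) := fun k => (fun q => q + (-(((k : ℝ) / J) • b))) ⁻¹' (s • Mac Ω x)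
  have hdisj : ∀ k l : ℕ, k < l → Disjoint (S k) (S l) := by
    intro k l hkl
    rw [Set.disjoint_left]
    intro q hk hl
    have h1 : (q + (-(((k : ℝ) / J) • b))) + -(q + (-(((l : ℝ) / J) • b))) ∈ (s + s) • Mac Ω x :=
      mac_smul_add hc hs.le hs.le hk (mac_smul_neg hl)
    have h2 : (((l : ℝ) - k) / J) • b ∈ (s + s) • Mac Ω x := by
      convert h1 using 1
      rw [sub_div]
      module
    have hlk : (1 : ℝ) ≤ (l : ℝ) - k := by
      have : (k : ℝ) + 1 ≤ l := by exact_mod_cast hkl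
      linarith
    have hne : (((l : ℝ) - k) / J) ≠ 0 := by
      have : 0 < (((l : ℝ) - k) / J) := by apply div_pos <;> linarith
      exact this.ne'
    have h3 := mem_smul_mac_of_smul x hne h2
    apply hb
    refine mac_smul_mono hc ?_ ?_ h3
    · apply div_nonneg (by linarith)
      apply div_nonneg <;> linarith
    · rw [div_div_eq_mul_div, div_le_iff₀ (by linarith)]
      have : 0 < 2 * s * J := by positivity
      nlinarith
  have hpd : Set.PairwiseDisjoint (↑(Finset.range J)) S := by
    intro k _ l _ hkl
    rcases lt_or_gt_of_ne hkl with h | h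
    · exact hdisj k l h
    · exact (hdisj l k h).symm
  have hvol : ∀ k, volume (S k) = volume (s • Mac Ω x) := fun k => measure_preimage_add_right _ _ _
  calc (J : ℝ≥0∞) * volume (s • Mac Ω x) = ∑ k ∈ Finset.range J, volume (S k) := by
        simp [hvol]
    _ = volume (⋃ k ∈ Finset.range J, S k) := by
        rw [measure_biUnion_finset hpd]
        intro k _
        exact (smul_mac_measurable hcomp x s).preimage (by fun_prop)
    _ ≤ volume E := by
        apply measure_mono
        intro q hq
        simp only [mem_iUnion] at hq
        obtain ⟨k, hk, hq⟩ := hq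
        have := hE k (Finset.mem_range.1 hk) _ hq
        convert this using 1
        module

lemma translates_le_real (hcomp : IsCompact Ω) (hc : Convex ℝ Ω) {x b m : Euc d} {s : ℝ} (hs : 0 < s)
    (J : ℕ) (hJ : 0 < J) (hb : b ∉ (2 * s * J) • Mac Ω x)
    (hE : ∀ k : ℕ, k < J → ∀ z ∈ s • Mac Ω x, ((k : ℝ) / J) • b + z ∈ Mac Ω m) :
    J * (s ^ d * mvol Ω x) ≤ mvol Ω m := by
  have h := translates_le hcomp hc hs J hJ hb hE
  have h2 := ENNReal.toReal_mono (mac_volume_lt_top hcomp m).ne h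
  rw [ENNReal.toReal_mul, vol_smul_real _ hs.le] at h2
  simpa [mvol] using h2

/-- explicit constants -/
def J1 (d : ℕ) : ℕ := 16 * 4 ^ d + 1
/-- explicit constants -/
def J2 (d : ℕ) : ℕ := 16 * (4 * J1 d) ^ d + 1
/-- explicit constants -/
def TT (d : ℕ) : ℝ := 2 * J1 d + 2 * J2 d

lemma half_mvol_le (hcomp : IsCompact Ω) (hc : Convex ℝ Ω) {v w : Euc d}
    (hv : v ∈ Ω) : (1 / 2 : ℝ) ^ d * mvol Ω w ≤ mvol Ω ((1 / 2 : ℝ) • (v + w)) := by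
  unfold mvol
  rw [← vol_smul_real _ (by norm_num)]
  apply ENNReal.toReal_mono (mac_volume_lt_top hcomp _).ne
  apply measure_mono
  rintro _ ⟨z, hz, rfl⟩
  refine ⟨?_, ?_⟩
  · have := hc hv hz.1 (a := 1 / 2) (b := 1 / 2) (by norm_num) (by norm_num) (by norm_num)
    convert this using 1
    module
  · have := hc hv hz.2 (a := 1 / 2) (b := 1 / 2) (by norm_num) (by norm_num) (by norm_num)
    convert this using 1
    module

lemma mac_compar1 (hcomp : IsCompact Ω) (hc : Convex ℝ Ω) {v w : Euc d}
    (hv : v ∈ Ω)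
    (hv0 : 0 < mvol Ω v) (hw0 : 0 < mvol Ω w)
    (h : mvol Ω ((1 / 2 : ℝ) • (v + w)) ^ 2 < 16 * (mvol Ω v * mvol Ω w)) :
    Mac Ω w ⊆ (2 * J1 d : ℝ) • Mac Ω v := by
  intro b hb
  by_contra hcon
  have hJ : 0 < J1 d := by unfold J1; positivity
  have hb' : (1 / 2 : ℝ) • b ∉ (2 * (1 / 2) * (J1 d : ℝ)) • Mac Ω v := by
    intro h1
    have := mem_smul_mac_of_smul v (by norm_num) h1
    apply hcon
    convert this using 2
    ring
  have h1 := translates_le_real hcomp hc (m := (1 / 2 : ℝ) • (v + w)) (by norm_num) (J1 d) hJ hb' ?_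
  · have h2 := half_mvol_le hcomp hc hv (w := w)
    have h3 : (J1 d : ℝ) * ((1 / 2) ^ d * mvol Ω v) * ((1 / 2) ^ d * mvol Ω w)
        ≤ mvol Ω ((1 / 2 : ℝ) • (v + w)) ^ 2 := by
      rw [sq]
      exact mul_le_mul h1 h2 (by positivity) (mvol_nonneg _)
    have h4 : (J1 d : ℝ) * ((1 / 2) ^ d * mvol Ω v) * ((1 / 2) ^ d * mvol Ω w)
        = ((J1 d : ℝ) / 4 ^ d) * (mvol Ω v * mvol Ω w) := by
      rw [show (4 : ℝ) = 2 * 2 by norm_num, mul_pow, one_div, inv_pow]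
      field_simp
    have h5 : (16 : ℝ) ≤ (J1 d : ℝ) / 4 ^ d := by
      rw [le_div_iff₀ (by positivity)]
      unfold J1; push_cast; linarith
    have h6 : 0 < mvol Ω v * mvol Ω w := by positivity
    nlinarith
  · rintro k hk _ ⟨c, hcm, rfl⟩
    have hJ' : (0 : ℝ) < J1 d := by exact_mod_cast hJ
    have hkb : ((k : ℝ) / J1 d) • b ∈ Mac Ω w := by
      apply mac_smul hc hb
      · have : (0 : ℝ) ≤ (k : ℝ) / J1 d := by positivity
        linarith
      · rw [div_le_one hJ']; exact_mod_cast hk.le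
    refine ⟨?_, ?_⟩
    · have := hc hcm.1 hkb.1 (a := 1 / 2) (b := 1 / 2) (by norm_num) (by norm_num) (by norm_num)
      convert this using 1
      module
    · have := hc hcm.2 hkb.2 (a := 1 / 2) (b := 1 / 2) (by norm_num) (by norm_num) (by norm_num)
      convert this using 1
      module

lemma mac_compar2 (hcomp : IsCompact Ω) (hc : Convex ℝ Ω) {v w : Euc d}
    (hv : v ∈ Ω)
    (hv0 : 0 < mvol Ω v) (hw0 : 0 < mvol Ω w)
    (hsub : Mac Ω v ⊆ (2 * J1 d : ℝ) • Mac Ω w)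
    (h : mvol Ω ((1 / 2 : ℝ) • (v + w)) ^ 2 < 16 * (mvol Ω v * mvol Ω w)) :
    w - v ∈ (2 * J2 d : ℝ) • Mac Ω v := by
  by_contra hcon
  have hJ : 0 < J2 d := by unfold J2; positivity
  have hJ1 : (1 : ℝ) ≤ J1 d := by
    have : 1 ≤ J1 d := by unfold J1; omega
    exact_mod_cast this
  have hs : (0 : ℝ) < 1 / (2 * J1 d) := by positivity
  have hs1 : (1 : ℝ) / (2 * J1 d) ≤ 1 := by
    rw [div_le_one (by positivity)]; linarith
  have hb' : (1 / 2 : ℝ) • (w - v) ∉ (2 * (1 / (2 * J1 d)) * (J2 d : ℝ)) • Mac Ω v := by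
    intro h1
    have := mem_smul_mac_of_smul v (by norm_num) h1
    apply hcon
    refine mac_smul_mono hc (by positivity) ?_ this
    have : (2 * (1 / (2 * (J1 d : ℝ))) * (J2 d : ℝ)) / (1 / 2) = 2 * J2 d * (1 / J1 d) := by
      field_simp
    rw [this]
    have : (1 : ℝ) / J1 d ≤ 1 := by rw [div_le_one (by positivity)]; linarith
    have h0 : (0 : ℝ) ≤ 2 * J2 d := by positivity
    nlinarith
  have h1 := translates_le_real hcomp hc (m := (1 / 2 : ℝ) • (v + w)) hs (J2 d) hJ hb' ?_
  · have h2 := half_mvol_le hcomp hc hv (w := w)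
    have h3 : (J2 d : ℝ) * ((1 / (2 * J1 d)) ^ d * mvol Ω v) * ((1 / 2) ^ d * mvol Ω w)
        ≤ mvol Ω ((1 / 2 : ℝ) • (v + w)) ^ 2 := by
      rw [sq]
      exact mul_le_mul h1 h2 (by positivity) (mvol_nonneg _)
    have h4 : (J2 d : ℝ) * ((1 / (2 * J1 d)) ^ d * mvol Ω v) * ((1 / 2) ^ d * mvol Ω w)
        = ((J2 d : ℝ) / (4 * J1 d) ^ d) * (mvol Ω v * mvol Ω w) := by
      rw [show (4 : ℝ) * J1 d = (2 * J1 d) * 2 by ring, mul_pow (2 * (J1 d : ℝ)) 2, one_div, inv_pow, one_div, inv_pow]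
      field_simp
    have h5 : (16 : ℝ) ≤ (J2 d : ℝ) / (4 * J1 d) ^ d := by
      rw [le_div_iff₀ (by positivity)]
      unfold J2; push_cast; linarith
    have h6 : 0 < mvol Ω v * mvol Ω w := by positivity
    nlinarith
  · rintro k hk _ ⟨c, hcm, rfl⟩
    have hJ' : (0 : ℝ) < J2 d := by exact_mod_cast hJ
    set s : ℝ := (k : ℝ) / J2 d with hsdef
    have hs0 : (0 : ℝ) ≤ s := by positivity
    have hs1' : s ≤ 1 := by rw [hsdef, div_le_one hJ']; exact_mod_cast hk.le
    have hc1 : (1 / (2 * J1 d : ℝ)) • c ∈ Mac Ω v := mac_smul hc hcm (by linarith) hs1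
    have hc2 : (1 / (2 * J1 d : ℝ)) • c ∈ Mac Ω w := by
      obtain ⟨e, he, hec⟩ := hsub hcm
      simp only at hec
      rw [← hec, smul_smul, one_div_mul_cancel (by positivity), one_smul]
      exact he
    set z := (1 / (2 * J1 d : ℝ)) • c
    refine ⟨?_, ?_⟩
    · have := hc hc1.1 hc2.1 (a := (1 - s) / 2) (b := (1 + s) / 2) (by linarith) (by linarith) (by ring)
      convert this using 1
      module
    · have := hc hc1.2 hc2.2 (a := (1 + s) / 2) (b := (1 - s) / 2) (by linarith) (by linarith) (by ring)
      convert this using 1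
      module

lemma TT_ge_one : 1 ≤ TT d := by
  unfold TT
  have : (1 : ℝ) ≤ J1 d := by
    have : 1 ≤ J1 d := by unfold J1; omega
    exact_mod_cast this
  have : (0 : ℝ) ≤ J2 d := by positivity
  linarith

/-- `w` is comparable to `v`. -/
def Compar (Ω : Set (Euc d)) (v w : Euc d) : Prop :=
  w - v ∈ TT d • Mac Ω v ∧ Mac Ω w ⊆ TT d • Mac Ω v ∧ Mac Ω v ⊆ TT d • Mac Ω w

lemma compar_of (hcomp : IsCompact Ω) (hc : Convex ℝ Ω) {v w : Euc d}
    (hv : v ∈ Ω) (hw : w ∈ Ω)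
    (hv0 : 0 < mvol Ω v) (hw0 : 0 < mvol Ω w)
    (h : mvol Ω ((1 / 2 : ℝ) • (v + w)) ^ 2 < 16 * (mvol Ω v * mvol Ω w)) : Compar Ω v w := by
  have h1 := mac_compar1 hcomp hc hv hv0 hw0 h
  have h2 := mac_compar1 hcomp hc hw hw0 hv0 (by rw [add_comm, mul_comm (mvol Ω w)]; exact h)
  have h3 := mac_compar2 hcomp hc hv hv0 hw0 h2 h
  have p1 : (0 : ℝ) ≤ J1 d := by positivity
  have p2 : (0 : ℝ) ≤ J2 d := by positivity
  refine ⟨?_, ?_, ?_⟩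
  · exact mac_smul_mono hc (by positivity) (by unfold TT; linarith) h3
  · exact h1.trans (mac_smul_mono hc (by positivity) (by unfold TT; linarith))
  · exact h2.trans (mac_smul_mono hc (by positivity) (by unfold TT; linarith))

/-- separated finite set -/
def SepSet (Ω : Set (Euc d)) (t : ℝ) (V : Finset (Euc d)) : Prop :=
  ∀ x ∈ V, ∀ y ∈ V, x ≠ y → y - x ∉ t • Mac Ω x

lemma sep_disjoint (hc : Convex ℝ Ω) {x y q : Euc d} {t : ℝ} (ht : 0 < t) (ht1 : t ≤ 1)
    (hxy : y - x ∉ t • Mac Ω x) (hx : q - x ∈ (t / 4) • Mac Ω x) (hy : q - y ∈ (t / 4) • Mac Ω y) :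
    False := by
  have h1 := mac_sub_mem hc (by linarith) (by linarith) hy
  have h2 := mac_sub_two hc (by linarith) (by linarith) hx
  have h3 := mac_smul_smul (s := 3 / 2 * (t / 4)) h2 h1
  have h4 := mac_smul_add hc (by linarith) (by linarith) h3 hx
  apply hxy
  have e1 : y - q + (q - x) = y - x := by abel
  rw [e1] at h4
  exact mac_smul_mono hc (by linarith) (by linarith) h4

lemma sep_pairwise (hc : Convex ℝ Ω) {t : ℝ} (ht : 0 < t) (ht1 : t ≤ 1) {V : Finset (Euc d)}
    (hV : SepSet Ω t V) :
    Set.PairwiseDisjoint (V : Set (Euc d)) (fun x => (fun q => q + -x) ⁻¹' ((t / 4) • Mac Ω x)) := by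
  intro x hx y hy hxy
  rw [Function.onFun, Set.disjoint_left]
  intro q h1 h2
  rw [mem_preimage, ← sub_eq_add_neg] at h1 h2
  exact sep_disjoint hc ht ht1 (hV x hx y hy hxy) h1 h2

lemma local_count (hcomp : IsCompact Ω) (hc : Convex ℝ Ω) {t : ℝ} (ht : 0 < t) (ht1 : t ≤ 1)
    {V : Finset (Euc d)} (hV : SepSet Ω t V) {v0 : Euc d} (hv0 : 0 < mvol Ω v0)
    (hcp : ∀ v ∈ V, Compar Ω v0 v) : (V.card : ℝ) ≤ (8 * TT d ^ 2 / t) ^ d := by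
  have hT := TT_ge_one (d := d)
  have hT0 : 0 < TT d := by linarith
  let S : Euc d → Set (Euc d) := fun x => (fun q => q + -x) ⁻¹' ((t / 4 / TT d) • Mac Ω v0)
  have hsub : ∀ v ∈ V, S v ⊆ (fun q => q + -v) ⁻¹' ((t / 4) • Mac Ω v) := by
    intro v hv q hq
    obtain ⟨_, _, h3⟩ := hcp v hv
    have := mac_smul_smul (s := t / 4 / TT d) h3 hq
    rwa [div_mul_cancel₀ _ hT0.ne'] at this
  have hpd : Set.PairwiseDisjoint (V : Set (Euc d)) S :=
    (sep_pairwise hc ht ht1 hV).mono_on hsub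
  have hvol : ∀ k, volume (S k) = volume ((t / 4 / TT d) • Mac Ω v0) :=
    fun k => measure_preimage_add_right _ _ _
  have key : (V.card : ℝ≥0∞) * volume ((t / 4 / TT d) • Mac Ω v0) ≤ volume ((2 * TT d) • Mac Ω v0) :=
    calc (V.card : ℝ≥0∞) * volume ((t / 4 / TT d) • Mac Ω v0) = ∑ v ∈ V, volume (S v) := by
          simp [hvol]
      _ = volume (⋃ v ∈ V, S v) := by
          rw [measure_biUnion_finset hpd]
          intro k _
          exact (smul_mac_measurable hcomp _ _).preimage (by fun_prop)
      _ ≤ volume ((fun q => q + -v0) ⁻¹' ((2 * TT d) • Mac Ω v0)) := by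
          apply measure_mono
          intro q hq
          simp only [mem_iUnion] at hq
          obtain ⟨v, hv, hq⟩ := hq
          have h2 := mac_smul_add hc (by positivity) hT0.le hq (hcp v hv).1
          have e1 : q + -v + (v - v0) = q + -v0 := by abel
          rw [e1] at h2
          refine mac_smul_mono hc (by positivity) ?_ h2
          have : t / 4 / TT d ≤ 1 := by
            rw [div_le_one hT0]; linarith
          linarith
      _ = _ := measure_preimage_add_right _ _ _
  have hfin : volume ((2 * TT d) • Mac Ω v0) ≠ ⊤ :=
    ((mac_isCompact hcomp v0).smul _).measure_lt_top.ne
  have h2 := ENNReal.toReal_mono hfin key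
  rw [ENNReal.toReal_mul, vol_smul_real _ (by positivity), vol_smul_real _ (by positivity)] at h2
  simp only [ENNReal.toReal_natCast] at h2
  change (V.card : ℝ) * ((t / 4 / TT d) ^ d * mvol Ω v0) ≤ (2 * TT d) ^ d * mvol Ω v0 at h2
  have h3 : (V.card : ℝ) * (t / 4 / TT d) ^ d ≤ (2 * TT d) ^ d := by
    rw [← mul_assoc] at h2
    exact le_of_mul_le_mul_right h2 hv0
  have e : (8 * TT d ^ 2 / t) = (2 * TT d) / (t / 4 / TT d) := by field_simp; ring
  rw [e, div_pow, le_div_iff₀ (by positivity)]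
  exact h3

lemma busemann_count (hd : 1 ≤ d) (hcomp : IsCompact Ω) (hc : Convex ℝ Ω) {t : ℝ} (ht : 0 < t) (ht1 : t ≤ 1)
    {V : Finset (Euc d)} (hV : SepSet Ω t V) {p : Euc d} {r ρ Λ R : ℝ} (hr : 0 < r)
    (hp : ball p r ⊆ Ω) (hΛ : Ω ⊆ closedBall p Λ) (hρ : 0 < ρ) (hVd : ∀ x ∈ V, ρ ≤ dep Ω x)
    (hR : (1 / 2) * Real.log ((1 + 2 * Λ / r) * (1 + 2 * Λ / (ρ / 2))) ≤ R) :
    (V.card : ℝ≥0∞) * (volume (ball (0 : Euc d) 1) * ENNReal.ofReal ((t / 16) ^ d))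
      ≤ busemannVol (interior Ω) (hilbertBall (interior Ω) p R) := by
  let S : Euc d → Set (Euc d) := fun x => (fun q => q + -x) ⁻¹' ((t / 4) • Mac Ω x)
  have hpd : Set.PairwiseDisjoint (V : Set (Euc d)) S := sep_pairwise hc ht ht1 hV
  have hmeas : ∀ x, MeasurableSet (S x) := fun x =>
    (smul_mac_measurable hcomp _ _).preimage (by fun_prop)
  have hdepq : ∀ x ∈ V, ∀ q ∈ S x, ρ / 2 ≤ dep Ω q := by
    intro x hx q hq
    have hq' : q - x ∈ (t / 4) • Mac Ω x := by rw [sub_eq_add_neg]; exact hq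
    have := dep_lip hd hcomp hc (by linarith) (by linarith) hq'
    have h2 := hVd x hx
    nlinarith
  have hone : ∀ x ∈ V, volume (ball (0 : Euc d) 1) * ENNReal.ofReal ((t / 16) ^ d)
      ≤ ∫⁻ q in S x, bdens (interior Ω) q := by
    intro x hx
    have hpos : 0 < mvol Ω x := by
      refine lt_of_lt_of_le ?_ (le_mvol hd hcomp x)
      have h1 : 0 < dep Ω x := lt_of_lt_of_le hρ (hVd x hx)
      have h2 : 0 < (volume (ball (0 : Euc d) 1)).toReal :=
        ENNReal.toReal_pos (measure_ball_pos _ _ one_pos).ne' measure_ball_lt_top.ne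
      positivity
    have hM0 : volume (Mac Ω x) ≠ 0 := fun h => by simp [mvol, h] at hpos
    have hMt := (mac_volume_lt_top hcomp x).ne
    have hb : ∀ q ∈ S x, volume (ball (0 : Euc d) 1) / volume ((4 : ℝ) • Mac Ω x) ≤ bdens (interior Ω) q := by
      intro q hq
      have hq' : q - x ∈ (t / 4) • Mac Ω x := by rw [sub_eq_add_neg]; exact hq
      have hqi : q ∈ interior Ω := mem_interior_of_dep (lt_of_lt_of_le (by linarith) (hdepq x hx q hq))
      refine le_trans ?_ (le_bdens hcomp hc hqi)
      gcongr
      have := mac_smul_smul (s := 2) (mac_sub_two hc (by linarith) (by linarith) hq')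
      norm_num at this
      exact this
    calc volume (ball (0 : Euc d) 1) * ENNReal.ofReal ((t / 16) ^ d)
        = volume (ball (0 : Euc d) 1) / volume ((4 : ℝ) • Mac Ω x) * volume (S x) := by
          have hS : volume (S x) = volume ((t / 4) • Mac Ω x) := measure_preimage_add_right _ _ _
          rw [hS, Measure.addHaar_smul, Measure.addHaar_smul]
          simp only [finrank_euclideanSpace, Fintype.card_fin]
          rw [abs_of_nonneg (by positivity), abs_of_nonneg (by positivity)]
          rw [show (t / 4) ^ d = (t / 16) ^ d * 4 ^ d by rw [← mul_pow]; congr 1; ring]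
          rw [ENNReal.ofReal_mul (by positivity)]
          have h4 : ENNReal.ofReal (4 ^ d) ≠ 0 := by simp
          have h4t : ENNReal.ofReal (4 ^ d) ≠ ⊤ := ENNReal.ofReal_ne_top
          have hZ0 := mul_ne_zero h4 hM0
          have hZt := ENNReal.mul_ne_top h4t hMt
          rw [mul_assoc (ENNReal.ofReal _)]
          generalize ENNReal.ofReal (4 ^ d) * volume (Mac Ω x) = Z at hZ0 hZt
          generalize ENNReal.ofReal _ = X
          rw [div_eq_mul_inv, mul_comm X Z, mul_assoc, ← mul_assoc _ Z X,
            ENNReal.inv_mul_cancel hZ0 hZt, one_mul]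
      _ = ∫⁻ q in S x, volume (ball (0 : Euc d) 1) / volume ((4 : ℝ) • Mac Ω x) := by
          rw [setLIntegral_const]
      _ ≤ _ := setLIntegral_mono' (hmeas x) hb
  calc (V.card : ℝ≥0∞) * (volume (ball (0 : Euc d) 1) * ENNReal.ofReal ((t / 16) ^ d))
      = ∑ x ∈ V, volume (ball (0 : Euc d) 1) * ENNReal.ofReal ((t / 16) ^ d) := by simp
    _ ≤ ∑ x ∈ V, ∫⁻ q in S x, bdens (interior Ω) q := Finset.sum_le_sum hone
    _ = ∫⁻ q in ⋃ x ∈ V, S x, bdens (interior Ω) q :=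
        (lintegral_biUnion_finset hpd (fun x _ => hmeas x) _).symm
    _ ≤ _ := by
        apply lintegral_mono_set
        intro q hq
        simp only [mem_iUnion] at hq
        obtain ⟨x, hx, hq⟩ := hq
        have h1 := hdepq x hx q hq
        have h2 : 0 < dep Ω q := lt_of_lt_of_le (by linarith) h1
        refine ⟨mem_interior_of_dep h2, ?_⟩
        exact (deep_hilbert hcomp hc hr hp hΛ (by linarith)
          ((ball_subset_ball h1).trans (dep_ball q))).trans hR

end Packing


section Faces
variable {d : ℕ}

lemma extreme_left {P F : Set (Euc d)} (h : IsExtreme ℝ P F) {x y z : Euc d} (hx : x ∈ P)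
    (hy : y ∈ P) (hz : z ∈ F) (hzs : z ∈ openSegment ℝ x y) : x ∈ F :=
  h.left_mem_of_mem_openSegment hx hy hz hzs

lemma extreme_eq_of_interior {P F : Set (Euc d)} (h : IsExtreme ℝ P F) {m : Euc d} (hm : m ∈ F)
    (hmi : m ∈ interior P) : F = P := by
  refine subset_antisymm h.subset fun x hx => ?_
  have hcont : Filter.Tendsto (fun s : ℝ => m + s • (m - x)) (𝓝[>] 0) (𝓝 m) := by
    have : Continuous (fun s : ℝ => m + s • (m - x)) := by fun_prop
    have h2 := this.tendsto 0
    simp only [zero_smul, add_zero] at h2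
    exact h2.mono_left nhdsWithin_le_nhds
  have hev := hcont.eventually (mem_interior_iff_mem_nhds.1 hmi)
  obtain ⟨s, hs, hs0⟩ := (hev.and self_mem_nhdsWithin).exists
  have hs0 : 0 < s := hs0
  refine extreme_left h hx hs hm ⟨s / (1 + s), 1 / (1 + s), by positivity, by positivity, ?_, ?_⟩
  · field_simp; ring
  · have e : m + s • (m - x) = (1 + s) • m - s • x := by module
    rw [e, smul_sub, smul_smul, smul_smul, one_div_mul_cancel (by positivity), one_smul,
      one_div_mul_eq_div]
    abel

lemma face_hull {V : Finset (Euc d)} {F : Set (Euc d)} (hc : Convex ℝ F)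
    (h : IsExtreme ℝ (convexHull ℝ (V : Set (Euc d))) F) :
    F = convexHull ℝ ((V.filter (· ∈ F) : Finset (Euc d)) : Set (Euc d)) := by
  apply subset_antisymm
  · intro x hx
    obtain ⟨w, hw0, hw1, hwx⟩ := (Finset.mem_convexHull).1 (h.subset hx)
    have hmem : ∀ v ∈ V, w v ≠ 0 → v ∈ F := by
      intro v hv hwv
      have hwpos : 0 < w v := lt_of_le_of_ne (hw0 v hv) (Ne.symm hwv)
      have hcm : V.centerMass w id = ∑ y ∈ V, w y • y := by
        rw [Finset.centerMass_eq_of_sum_1 _ _ hw1]; rfl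
      rw [hcm, ← Finset.add_sum_erase _ _ hv] at hwx
      rw [← Finset.add_sum_erase _ _ hv] at hw1
      have hrest0 : 0 ≤ ∑ y ∈ V.erase v, w y :=
        Finset.sum_nonneg fun y hy => hw0 y (Finset.mem_of_mem_erase hy)
      rcases eq_or_lt_of_le hrest0 with h0 | h0
      · have hall : ∀ y ∈ V.erase v, w y = 0 :=
          (Finset.sum_eq_zero_iff_of_nonneg (fun y hy => hw0 y (Finset.mem_of_mem_erase hy))).1 h0.symm
        have hz : ∑ y ∈ V.erase v, w y • y = 0 :=
          Finset.sum_eq_zero fun y hy => by rw [hall y hy, zero_smul]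
        rw [hz, add_zero] at hwx
        have : w v = 1 := by linarith
        rw [this, one_smul] at hwx
        rw [hwx]; exact hx
      · set q := (V.erase v).centerMass w id with hq
        have hqP : q ∈ convexHull ℝ (V : Set (Euc d)) := by
          apply Finset.centerMass_mem_convexHull _ (fun y hy => hw0 y (Finset.mem_of_mem_erase hy)) h0
          intro y hy
          exact Finset.mem_of_mem_erase hy
        refine extreme_left h (subset_convexHull ℝ _ hv) hqP hx
          ⟨w v, ∑ y ∈ V.erase v, w y, hwpos, h0, hw1, ?_⟩
        rw [hq, Finset.centerMass, smul_smul, mul_inv_cancel₀ h0.ne', one_smul, ← hwx]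
        rfl
    rw [Finset.mem_convexHull]
    refine ⟨w, fun y hy => hw0 y (Finset.mem_filter.1 hy).1, ?_, ?_⟩
    · rw [Finset.sum_filter_of_ne, hw1]
      exact fun y hy hne => hmem y hy hne
    · rw [← hwx]
      apply Finset.centerMass_subset
      · exact Finset.filter_subset _ _
      · intro y hy hny
        by_contra hne
        exact hny (Finset.mem_filter.2 ⟨hy, hmem y hy hne⟩)
  · apply convexHull_min _ hc
    intro x hx
    exact (Finset.mem_filter.1 hx).2

lemma span_top_of_faceDim {F : Set (Euc d)} (hne : F.Nonempty) (h : faceDim F = d) :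
    affineSpan ℝ F = ⊤ := by
  have h1 : (affineSpan ℝ F).direction = ⊤ := by
    apply Submodule.eq_top_of_finrank_eq
    rw [show Module.finrank ℝ (affineSpan ℝ F).direction = d from h]
    simp
  rwa [AffineSubspace.direction_eq_top_iff_of_nonempty ((affineSpan_nonempty ℝ).2 hne)] at h1

lemma faceDim_of_span_top {F : Set (Euc d)} (h : affineSpan ℝ F = ⊤) : faceDim F = d := by
  unfold faceDim
  rw [h, AffineSubspace.direction_top, finrank_top]
  simp

lemma faceDim_of_interior {F : Set (Euc d)} (h : (interior F).Nonempty) : faceDim F = d := by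
  apply faceDim_of_span_top
  have h1 : affineSpan ℝ (interior F) = ⊤ := isOpen_interior.affineSpan_eq_top h
  rw [eq_top_iff, ← h1]
  exact affineSpan_mono ℝ interior_subset

lemma face_full {P F : Set (Euc d)} (hF : IsFace P F) (h : faceDim F = d) : F = P := by
  obtain ⟨hne, -, hc, hex⟩ := hF
  have h1 := span_top_of_faceDim hne h
  rw [← hc.interior_nonempty_iff_affineSpan_eq_top] at h1
  obtain ⟨m, hm⟩ := h1
  exact extreme_eq_of_interior hex (interior_subset hm) (interior_mono hex.subset hm)

lemma flags_card (hd : 1 ≤ d) {V : Finset (Euc d)} {Rel : Euc d → Euc d → Prop}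
    (hdim : faceDim (convexHull ℝ (V : Set (Euc d))) = d)
    (hrel : ∀ v ∈ V, ∀ w ∈ V, (1 / 2 : ℝ) • (v + w) ∉ interior (convexHull ℝ (V : Set (Euc d))) → Rel v w)
    {Q : ℕ} (hQ : ∀ v ∈ V, (V.filter (Rel v)).card ≤ Q) :
    (flagSet d (convexHull ℝ (V : Set (Euc d)))).ncard ≤ V.card * (2 ^ Q) ^ d := by
  set P := convexHull ℝ (V : Set (Euc d)) with hP
  let Φ : (Fin (d + 1) → Set (Euc d)) → (Fin d → Finset (Euc d)) :=
    fun f i => V.filter (· ∈ f i.castSucc)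
  let Tgt : Finset (Fin d → Finset (Euc d)) :=
    V.biUnion fun v0 => Fintype.piFinset fun _ : Fin d => (V.filter (Rel v0)).powerset
  have hTgt : Tgt.card ≤ V.card * (2 ^ Q) ^ d := by
    refine Finset.card_biUnion_le_card_mul _ _ _ fun v hv => ?_
    rw [Fintype.card_piFinset]
    simp only [Finset.card_powerset, Finset.prod_const, Finset.card_univ, Fintype.card_fin]
    gcongr
    · norm_num
    · exact hQ v hv
  have hmaps : ∀ f ∈ flagSet d P, Φ f ∈ (Tgt : Set (Fin d → Finset (Euc d))) := by
    intro f hf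
    obtain ⟨hf1, hf2⟩ := hf
    let l : Fin (d + 1) := ⟨d - 1, by omega⟩
    have hl : ∀ m ∈ f l, m ∉ interior P := by
      intro m hm hmi
      have := extreme_eq_of_interior (hf1 l).1.2.2.2 hm hmi
      have h2 := (hf1 l).2
      rw [this, hdim] at h2
      change d = d - 1 at h2
      omega
    obtain ⟨hne, -, hcv, hex⟩ := (hf1 0).1
    have h0 := face_hull hcv hex
    have : ((V.filter (· ∈ f 0) : Finset (Euc d)) : Set (Euc d)).Nonempty := by
      rw [← convexHull_nonempty_iff (𝕜 := ℝ), ← h0]; exact hne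
    obtain ⟨v0, hv0⟩ := this
    have hv0 := Finset.mem_filter.1 (Finset.mem_coe.1 hv0)
    rw [Finset.mem_coe, Finset.mem_biUnion]
    refine ⟨v0, hv0.1, ?_⟩
    rw [Fintype.mem_piFinset]
    intro i
    rw [Finset.mem_powerset]
    intro v hv
    have hv := Finset.mem_filter.1 hv
    rw [Finset.mem_filter]
    refine ⟨hv.1, hrel v0 hv0.1 v hv.1 (hl _ ?_)⟩
    have a1 : v0 ∈ f l := hf2 0 l (Fin.zero_le _) hv0.2
    have a2 : v ∈ f l := hf2 i.castSucc l (by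
      rw [Fin.le_def]; change (i : ℕ) ≤ d - 1; omega) hv.2
    have hcvl : Convex ℝ (f l) := (hf1 l).1.2.2.1
    have := hcvl a1 a2 (a := 1 / 2) (b := 1 / 2) (by norm_num) (by norm_num) (by norm_num)
    rwa [smul_add]
  have hinj : Set.InjOn Φ (flagSet d P) := by
    intro f hf g hg hfg
    funext i
    refine Fin.lastCases ?_ (fun j => ?_) i
    · rw [face_full (hf.1 (Fin.last d)).1 (hf.1 (Fin.last d)).2,
        face_full (hg.1 (Fin.last d)).1 (hg.1 (Fin.last d)).2]
    · have h1 := face_hull (hf.1 j.castSucc).1.2.2.1 (hf.1 j.castSucc).1.2.2.2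
      have h2 := face_hull (hg.1 j.castSucc).1.2.2.1 (hg.1 j.castSucc).1.2.2.2
      have h3 : V.filter (· ∈ f j.castSucc) = V.filter (· ∈ g j.castSucc) := congrFun hfg j
      rw [h1, h2, h3]
  have h := Set.ncard_le_ncard_of_injOn Φ hmaps hinj (Finset.finite_toSet _)
  rw [Set.ncard_coe_finset] at h
  exact h.trans hTgt

end Faces


section Net
variable {d : ℕ} {Ω : Set (Euc d)}

/-- The weight used to define the level sets. -/
def GG (Ω : Set (Euc d)) (n : ℕ) (x : Euc d) : ℝ := dep Ω x ^ n * mvol Ω x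

lemma GG_pos_dep {n : ℕ} (hn : 1 ≤ n) {x : Euc d} (h : 0 < GG Ω n x) : 0 < dep Ω x := by
  rcases eq_or_lt_of_le (dep_nonneg (Ω := Ω) x) with h0 | h0
  · unfold GG at h
    rw [← h0, zero_pow (by omega), zero_mul] at h
    exact absurd h (lt_irrefl _)
  · exact h0

lemma GG_pos_mvol {n : ℕ} {x : Euc d} (h : 0 < GG Ω n x) : 0 < mvol Ω x := by
  rcases eq_or_lt_of_le (mvol_nonneg (Ω := Ω) x) with h0 | h0
  · unfold GG at h
    rw [← h0, mul_zero] at h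
    exact absurd h (lt_irrefl _)
  · exact h0

lemma mem_of_dep_pos {x : Euc d} (h : 0 < dep Ω x) : x ∈ Ω :=
  dep_ball (Ω := Ω) x (mem_ball_self h)

lemma GG_lip (hd : 1 ≤ d) (hcomp : IsCompact Ω) (hc : Convex ℝ Ω) {n : ℕ} {x y : Euc d} {s : ℝ}
    (h0 : 0 ≤ s) (h1 : s < 1) (hs : 1 / 2 ≤ (1 - s) ^ (n + d))
    (h : y - x ∈ s • Mac Ω x) : GG Ω n x / 2 ≤ GG Ω n y := by
  have a1 := dep_lip hd hcomp hc h0 h1 h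
  have a2 := mvol_lip hcomp hc h0 h1.le h
  have b1 : ((1 - s) * dep Ω x) ^ n ≤ dep Ω y ^ n :=
    pow_le_pow_left₀ (mul_nonneg (by linarith) (dep_nonneg x)) a1 n
  have b2 := mul_le_mul b1 a2 (mul_nonneg (pow_nonneg (by linarith) d) (mvol_nonneg x)) (pow_nonneg (dep_nonneg y) n)
  have b3 : 0 ≤ GG Ω n x := mul_nonneg (pow_nonneg (dep_nonneg x) n) (mvol_nonneg x)
  calc GG Ω n x / 2 = 1 / 2 * GG Ω n x := by ring
    _ ≤ (1 - s) ^ (n + d) * GG Ω n x := by gcongr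
    _ = ((1 - s) * dep Ω x) ^ n * ((1 - s) ^ d * mvol Ω x) := by unfold GG; rw [mul_pow, pow_add]; ring
    _ ≤ _ := b2

lemma zero_mem_mac {x : Euc d} (h : x ∈ Ω) : (0 : Euc d) ∈ Mac Ω x := by
  constructor <;> simpa using h

lemma max_net {K : Set (Euc d)} (hK : K ⊆ Ω) {t : ℝ} {M : ℕ}
    (hM : ∀ V : Finset (Euc d), SepSet Ω t V → (∀ v ∈ V, v ∈ K) → V.card ≤ M) :
    ∃ V : Finset (Euc d), SepSet Ω t V ∧ (∀ v ∈ V, v ∈ K) ∧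
      ∀ y ∈ K, ∃ x ∈ V, y - x ∈ t • Mac Ω x ∨ x - y ∈ t • Mac Ω y := by
  let S : Set ℕ := {k | ∃ V : Finset (Euc d), (SepSet Ω t V ∧ ∀ v ∈ V, v ∈ K) ∧ V.card = k}
  have hS : S.Nonempty := ⟨0, ∅, ⟨by intro x hx; simp at hx, by simp⟩, rfl⟩
  have hb : BddAbove S := ⟨M, by rintro k ⟨V, hV, rfl⟩; exact hM V hV.1 hV.2⟩
  obtain ⟨V, ⟨hV1, hV2⟩, hV3⟩ := Nat.sSup_mem hS hb
  refine ⟨V, hV1, hV2, fun y hy => ?_⟩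
  by_cases hyV : y ∈ V
  · refine ⟨y, hyV, Or.inl ?_⟩
    rw [sub_self]
    exact ⟨0, zero_mem_mac (hK hy), smul_zero _⟩
  by_contra hcon
  push Not at hcon
  have hsep : SepSet Ω t (insert y V) := by
    intro a ha b hb hab
    rcases Finset.mem_insert.1 ha with rfl | ha'
    · rcases Finset.mem_insert.1 hb with rfl | hb'
      · exact absurd rfl hab
      · exact (hcon b hb').2
    · rcases Finset.mem_insert.1 hb with rfl | hb'
      · exact (hcon a ha').1
      · exact hV1 a ha' b hb' hab
  have h1 : (insert y V).card ∈ S := ⟨insert y V, ⟨hsep, by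
    intro v hv
    rcases Finset.mem_insert.1 hv with rfl | hv
    · exact hy
    · exact hV2 v hv⟩, rfl⟩
  have h2 := le_csSup hb h1
  rw [← hV3, Finset.card_insert_of_notMem hyV] at h2
  omega

lemma net_cover (hcomp : IsCompact Ω) (hc : Convex ℝ Ω) {V : Finset (Euc d)} {K : Set (Euc d)}
    {s : ℝ} (hs0 : 0 < s) (hs1 : s ≤ 1 / 4)
    (hnet : ∀ y ∈ K, ∃ x ∈ V, y - x ∈ (s / 8) • Mac Ω x ∨ x - y ∈ (s / 8) • Mac Ω y)
    {x : Euc d} (hx : x ∈ Ω) (hxK : ∀ y, y - x ∈ s • Mac Ω x → y ∈ K) :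
    x ∈ convexHull ℝ (V : Set (Euc d)) := by
  by_contra hcon
  obtain ⟨f, u, hf1, hf2⟩ := geometric_hahn_banach_closed_point (convex_convexHull ℝ (V : Set (Euc d)))
    (V.finite_toSet.isClosed_convexHull ℝ) hcon
  obtain ⟨a, ha, hmax⟩ := (mac_isCompact hcomp x).exists_isMaxOn ⟨0, zero_mem_mac hx⟩
    f.continuous.continuousOn
  have hmax : ∀ z ∈ Mac Ω x, f z ≤ f a := hmax
  have ha0 : 0 ≤ f a := by simpa using hmax 0 (zero_mem_mac hx)
  set y := x + s • a with hy
  have hyx : y - x ∈ s • Mac Ω x := ⟨a, ha, by simp [hy]⟩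
  obtain ⟨v, hvV, hv⟩ := hnet y (hxK y hyx)
  have h1 : y - v ∈ (s / 4) • Mac Ω y := by
    rcases hv with h | h
    · have h2 := mac_sub_mem hc (by linarith) (by linarith) h
      have h3 := mac_smul_neg h2
      rw [neg_sub] at h3
      exact mac_smul_mono hc (by linarith) (by linarith) h3
    · have h3 := mac_smul_neg h
      rw [neg_sub] at h3
      exact mac_smul_mono hc (by linarith) (by linarith) h3
  have h2 := mac_sub_two hc (by linarith) (by linarith) hyx
  obtain ⟨b, hb, hb'⟩ := mac_smul_smul (s := s / 4) h2 h1
  have hb' : (s / 4 * 2) • b = y - v := hb'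
  have e : f v = f x + s * f a - (s / 4 * 2) * f b := by
    have : v = x + s • a - (s / 4 * 2) • b := by rw [hb', hy]; abel
    rw [this]; simp
  have h3 := hf1 v (subset_convexHull ℝ _ hvV)
  have h4 := hmax b hb
  nlinarith

lemma net_poly (hd : 1 ≤ d) (hcomp : IsCompact Ω) (hc : Convex ℝ Ω) {n : ℕ} (hn : 1 ≤ n)
    {e s : ℝ} (he : 0 < e) (hs0 : 0 < s) (hs1 : s ≤ 1 / 4) (hs : 1 / 2 ≤ (1 - s) ^ (n + d))
    {M : ℕ} (hM : ∀ V : Finset (Euc d), SepSet Ω (s / 8) V → (∀ v ∈ V, e ≤ GG Ω n v) → V.card ≤ M)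
    {p : Euc d} (hp : 4 * e ≤ GG Ω n p) :
    ∃ V : Finset (Euc d), SepSet Ω (s / 8) V ∧ (∀ v ∈ V, e ≤ GG Ω n v) ∧
      (∀ x, 2 * e ≤ GG Ω n x → x ∈ convexHull ℝ (V : Set (Euc d))) ∧
      faceDim (convexHull ℝ (V : Set (Euc d))) = d ∧
      (flagSet d (convexHull ℝ (V : Set (Euc d)))).ncard
        ≤ V.card * (2 ^ ⌊(8 * TT d ^ 2 / (s / 8)) ^ d⌋₊) ^ d := by
  have hK : {x | e ≤ GG Ω n x} ⊆ Ω := fun x hx =>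
    mem_of_dep_pos (GG_pos_dep hn (lt_of_lt_of_le he hx))
  obtain ⟨V, hV1, hV2, hV3⟩ := max_net hK hM
  have hcov : ∀ x, 2 * e ≤ GG Ω n x → x ∈ convexHull ℝ (V : Set (Euc d)) := by
    intro x hx
    refine net_cover hcomp hc hs0 hs1 hV3 (hK (show e ≤ GG Ω n x by linarith)) fun y hy => ?_
    have := GG_lip hd hcomp hc hs0.le (by linarith) hs hy
    show e ≤ GG Ω n y
    linarith
  have hint : ∀ x, 4 * e ≤ GG Ω n x → x ∈ interior (convexHull ℝ (V : Set (Euc d))) := by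
    intro x hx
    have hdp : 0 < dep Ω x := GG_pos_dep hn (by linarith)
    rw [mem_interior]
    refine ⟨ball x (s * dep Ω x), fun y hy => hcov y ?_, isOpen_ball, mem_ball_self (by positivity)⟩
    have hyx : y - x ∈ s • Mac Ω x := by
      rw [Set.mem_smul_set_iff_inv_smul_mem₀ hs0.ne']
      apply mac_ball (dep_ball (Ω := Ω) x)
      rw [mem_ball_zero_iff, norm_smul, norm_inv, Real.norm_of_nonneg hs0.le, inv_mul_lt_iff₀ hs0,
        ← dist_eq_norm]
      exact hy
    have := GG_lip hd hcomp hc hs0.le (by linarith) hs hyx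
    linarith
  have hdim : faceDim (convexHull ℝ (V : Set (Euc d))) = d := faceDim_of_interior ⟨p, hint p hp⟩
  refine ⟨V, hV1, hV2, hcov, hdim, ?_⟩
  refine flags_card hd (Rel := Compar Ω) hdim ?_ ?_
  · intro v hv w hw hm
    have gv : e ≤ GG Ω n v := hV2 v hv
    have gw : e ≤ GG Ω n w := hV2 w hw
    have hv0 := GG_pos_dep hn (lt_of_lt_of_le he gv)
    have hw0 := GG_pos_dep hn (lt_of_lt_of_le he gw)
    refine compar_of hcomp hc (mem_of_dep_pos hv0) (mem_of_dep_pos hw0)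
      (GG_pos_mvol (lt_of_lt_of_le he gv)) (GG_pos_mvol (lt_of_lt_of_le he gw)) ?_
    have hm' : GG Ω n ((1 / 2 : ℝ) • (v + w)) < 4 * e := by
      by_contra hcon
      exact hm (hint _ (not_lt.1 hcon))
    have hmid := dep_mid hd hcomp hc hv0 hw0
    set m := (1 / 2 : ℝ) • (v + w)
    have hm0 : 0 ≤ GG Ω n m := mul_nonneg (pow_nonneg (dep_nonneg m) n) (mvol_nonneg m)
    have h1 : GG Ω n m ^ 2 < 16 * e ^ 2 := by nlinarith
    have h2 : e ^ 2 ≤ GG Ω n v * GG Ω n w := by nlinarith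
    have h3 : (dep Ω v * dep Ω w) ^ n ≤ (dep Ω m ^ 2) ^ n :=
      pow_le_pow_left₀ (by positivity) hmid n
    have h4 : GG Ω n v * GG Ω n w ≤ (dep Ω m ^ 2) ^ n * (mvol Ω v * mvol Ω w) := by
      calc GG Ω n v * GG Ω n w = (dep Ω v * dep Ω w) ^ n * (mvol Ω v * mvol Ω w) := by
            unfold GG; rw [mul_pow]; ring
        _ ≤ _ := mul_le_mul_of_nonneg_right h3 (mul_nonneg (mvol_nonneg v) (mvol_nonneg w))
    have h5 : GG Ω n m ^ 2 = (dep Ω m ^ 2) ^ n * mvol Ω m ^ 2 := by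
      unfold GG; rw [mul_pow, ← pow_mul, ← pow_mul, mul_comm 2 n]
    have h6 : (dep Ω m ^ 2) ^ n * mvol Ω m ^ 2 < (dep Ω m ^ 2) ^ n * (16 * (mvol Ω v * mvol Ω w)) := by
      rw [← h5]; nlinarith
    exact lt_of_mul_lt_mul_left h6 (by positivity)
  · intro v hv
    apply Nat.le_floor
    refine local_count hcomp hc (by linarith) (by linarith) (V := V.filter (Compar Ω v)) ?_
      (GG_pos_mvol (lt_of_lt_of_le he (hV2 v hv))) ?_
    · intro a ha b hb hab
      exact hV1 a (Finset.mem_filter.1 ha).1 b (Finset.mem_filter.1 hb).1 hab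
    · intro w hw
      exact (Finset.mem_filter.1 hw).2

end Net


section UpperN
variable {d : ℕ} {Ω : Set (Euc d)}

/-- volume of the Euclidean unit ball -/
def om (d : ℕ) : ℝ := (volume (ball (0 : Euc d) 1)).toReal

lemma om_pos (d : ℕ) : 0 < om d :=
  ENNReal.toReal_pos (measure_ball_pos _ _ one_pos).ne' measure_ball_lt_top.ne

lemma om_ofReal (d : ℕ) : volume (ball (0 : Euc d) 1) = ENNReal.ofReal (om d) :=
  (ENNReal.ofReal_toReal measure_ball_lt_top.ne).symm

lemma bdens_le_real (hcomp : IsCompact Ω) (hc : Convex ℝ Ω) {x : Euc d} (hx : x ∈ interior Ω)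
    {m : ℝ} (hm : 0 < m) (hmx : m ≤ mvol Ω x) :
    bdens (interior Ω) x ≤ ENNReal.ofReal (om d * 2 ^ d / m) := by
  refine (bdens_le hcomp hc hx).trans ?_
  have h1 : volume ((1 / 2 : ℝ) • Mac Ω x) = ENNReal.ofReal ((1 / 2) ^ d * mvol Ω x) := by
    rw [mvol, ← vol_smul_real _ (by norm_num), ENNReal.ofReal_toReal]
    rw [Measure.addHaar_smul]
    exact ENNReal.mul_ne_top ENNReal.ofReal_ne_top (mac_volume_lt_top hcomp x).ne
  have hpos : 0 < (1 / 2 : ℝ) ^ d * mvol Ω x := by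
    have : 0 < mvol Ω x := lt_of_lt_of_le hm hmx
    positivity
  rw [h1, om_ofReal, ← ENNReal.ofReal_div_of_pos hpos]
  apply ENNReal.ofReal_le_ofReal
  have ho := om_pos d
  rw [div_le_div_iff₀ hpos hm]
  have : (2 : ℝ) ^ d * (1 / 2) ^ d = 1 := by rw [← mul_pow]; norm_num
  calc om d * m ≤ om d * mvol Ω x := by gcongr
    _ = om d * 2 ^ d * ((1 / 2) ^ d * mvol Ω x) := by
      rw [show om d * 2 ^ d * ((1 / 2) ^ d * mvol Ω x) = om d * mvol Ω x * (2 ^ d * (1 / 2) ^ d) by ring,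
        this, mul_one]

lemma dep_measurable (ρ : ℝ) : MeasurableSet {x : Euc d | ρ ≤ dep Ω x} :=
  (isClosed_le continuous_const (continuous_infDist_pt _)).measurableSet

lemma vol_crude (hd : 1 ≤ d) (hcomp : IsCompact Ω) (hc : Convex ℝ Ω) {p : Euc d} {r R : ℝ} (hr : 0 < r)
    (hp : ball p r ⊆ Ω) (hR : 0 ≤ R) :
    busemannVol (interior Ω) (hilbertBall (interior Ω) p R)
      ≤ ENNReal.ofReal (2 ^ d / (Real.exp (-2 * R) * r) ^ d * (volume Ω).toReal) := by
  set ρ := Real.exp (-2 * R) * r with hρ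
  have hρ0 : 0 < ρ := by positivity
  have ho := om_pos d
  have hsub : hilbertBall (interior Ω) p R ⊆ {x | ρ ≤ dep Ω x} := fun x hx =>
    le_dep hd hcomp (hilbert_deep hcomp hc hr hp hR hx)
  have hsub2 : {x | ρ ≤ dep Ω x} ⊆ Ω := fun x hx => mem_of_dep_pos (lt_of_lt_of_le hρ0 hx)
  calc busemannVol (interior Ω) (hilbertBall (interior Ω) p R)
      ≤ ∫⁻ x in {x | ρ ≤ dep Ω x}, bdens (interior Ω) x := lintegral_mono_set hsub
    _ ≤ ∫⁻ x in {x | ρ ≤ dep Ω x}, ENNReal.ofReal (2 ^ d / ρ ^ d) := by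
        apply setLIntegral_mono' (dep_measurable ρ)
        intro x hx
        have hx : ρ ≤ dep Ω x := hx
        have h1 : 0 < dep Ω x := lt_of_lt_of_le hρ0 hx
        have h2 : ρ ^ d * om d ≤ mvol Ω x := by
          refine le_trans ?_ (le_mvol hd hcomp x)
          unfold om
          gcongr
        refine (bdens_le_real hcomp hc (mem_interior_of_dep h1) (by positivity) h2).trans ?_
        apply le_of_eq
        congr 1
        field_simp
    _ = ENNReal.ofReal (2 ^ d / ρ ^ d) * volume {x | ρ ≤ dep Ω x} := setLIntegral_const _ _
    _ ≤ ENNReal.ofReal (2 ^ d / ρ ^ d) * volume Ω := by gcongr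
    _ = _ := by
      rw [ENNReal.ofReal_mul (by positivity), ENNReal.ofReal_toReal hcomp.measure_lt_top.ne]

lemma B_core (hd : 1 ≤ d) (hcomp : IsCompact Ω) (hc : Convex ℝ Ω) {p : Euc d} {r Λ R : ℝ} (hr : 0 < r)
    (hp : ball p r ⊆ Ω) (hR : 0 ≤ R) (hΛ : Ω ⊆ closedBall p Λ) {n : ℕ} (hn : 1 ≤ n)
    {s : ℝ} (hs0 : 0 < s) (hs1 : s ≤ 1 / 4) (hs : 1 / 2 ≤ (1 - s) ^ (n + d))
    {F0 ρ σ : ℝ} (hF0 : 1 ≤ F0) (hF1 : (volume Ω).toReal ≤ F0) (hρ : 0 < ρ)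
    (hRρ : (1 / 2) * Real.log ((1 + 2 * Λ / r) * (1 + 2 * Λ / (ρ / 2))) ≤ R)
    (h1 : 4 * (F0 * ρ) ^ n ≤ r ^ (n + d) * om d)
    (hσ0 : 0 < σ) (hσr : σ ≤ r) (h2 : 2 * (F0 * ρ) ^ n ≤ σ ^ (n + d) * om d) :
    ∃ V : Finset (Euc d), V.Nonempty ∧
    faceDim (convexHull ℝ (V : Set (Euc d))) = d ∧
    Metric.hausdorffDist (convexHull ℝ (V : Set (Euc d))) Ω ≤ σ * Λ / r ∧
    (V.card : ℝ) * (om d * (s / 8 / 16) ^ d)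
      ≤ (busemannVol (interior Ω) (hilbertBall (interior Ω) p R)).toReal ∧
    (flagSet d (convexHull ℝ (V : Set (Euc d)))).ncard
        ≤ V.card * (2 ^ ⌊(8 * TT d ^ 2 / (s / 8)) ^ d⌋₊) ^ d := by
  have ho := om_pos d
  set e := (F0 * ρ) ^ n with he
  have he0 : 0 < e := by positivity
  have hfin : busemannVol (interior Ω) (hilbertBall (interior Ω) p R) ≠ ⊤ :=
    ((vol_crude hd hcomp hc hr hp hR).trans_lt ENNReal.ofReal_lt_top).ne
  have hlow : ∀ (x : Euc d) (τ : ℝ), 0 ≤ τ → τ ≤ dep Ω x → τ ^ (n + d) * om d ≤ GG Ω n x := by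
    intro x τ h0 hτ
    unfold GG
    calc τ ^ (n + d) * om d ≤ dep Ω x ^ (n + d) * om d := by gcongr
      _ = dep Ω x ^ n * (dep Ω x ^ d * om d) := by rw [pow_add]; ring
      _ ≤ _ := by
        gcongr
        · exact pow_nonneg (dep_nonneg x) n
        · exact le_mvol hd hcomp x
  have hKd : ∀ x, e ≤ GG Ω n x → ρ ≤ dep Ω x := by
    intro x hx
    have a1 : GG Ω n x ≤ (F0 * dep Ω x) ^ n := by
      unfold GG
      rw [mul_pow, mul_comm]
      have : mvol Ω x ≤ F0 ^ n := ((mvol_le hcomp x).trans hF1).trans (le_self_pow₀ hF0 (by omega))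
      gcongr
      exact pow_nonneg (dep_nonneg x) n
    have a2 := le_of_pow_le_pow_left₀ (by omega) (mul_nonneg (by linarith) (dep_nonneg x)) (hx.trans a1)
    exact le_of_mul_le_mul_left a2 (by linarith)
  have hcount : ∀ V : Finset (Euc d), SepSet Ω (s / 8) V → (∀ v ∈ V, e ≤ GG Ω n v) →
      (V.card : ℝ) * (om d * (s / 8 / 16) ^ d)
      ≤ (busemannVol (interior Ω) (hilbertBall (interior Ω) p R)).toReal := by
    intro V hV hVe
    have := busemann_count hd hcomp hc (by linarith) (by linarith) hV hr hp hΛ hρ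
      (fun x hx => hKd x (hVe x hx)) hRρ
    have := ENNReal.toReal_mono hfin this
    rw [ENNReal.toReal_mul, ENNReal.toReal_mul, ENNReal.toReal_ofReal (by positivity)] at this
    exact this
  have hM : ∀ V : Finset (Euc d), SepSet Ω (s / 8) V → (∀ v ∈ V, e ≤ GG Ω n v) → V.card ≤
      ⌊(busemannVol (interior Ω) (hilbertBall (interior Ω) p R)).toReal / (om d * (s / 8 / 16) ^ d)⌋₊ := by
    intro V hV hVe
    apply Nat.le_floor
    rw [le_div_iff₀ (by positivity)]
    exact hcount V hV hVe
  obtain ⟨V, hV1, hV2, hV3, hV4, hV5⟩ := net_poly hd hcomp hc hn he0 hs0 hs1 hs hM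
    (h1.trans (hlow p r hr.le (le_dep hd hcomp hp)))
  have hΛ0 : 0 ≤ Λ := by
    have := hΛ (hp (mem_ball_self hr))
    simpa using this
  have hpV : p ∈ convexHull ℝ (V : Set (Euc d)) := hV3 p (by
    have := h1.trans (hlow p r hr.le (le_dep hd hcomp hp)); linarith)
  refine ⟨V, ?_, hV4, ?_, hcount V hV1 hV2, hV5⟩
  · have : (convexHull ℝ (V : Set (Euc d))).Nonempty := ⟨p, hpV⟩
    rw [convexHull_nonempty_iff] at this
    exact this
  · apply hausdorffDist_le_of_mem_dist (by positivity)
    · intro x hx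
      refine ⟨x, ?_, by rw [dist_self]; positivity⟩
      refine convexHull_min ?_ hc hx
      intro v hv
      exact mem_of_dep_pos (lt_of_lt_of_le hρ (hKd v (hV2 v hv)))
    · intro x hx
      have hb := ball_combo hc hp hx (t := 1 - σ / r) (by
        rw [sub_nonneg, div_le_one hr]; exact hσr) (by
        have : 0 < σ / r := by positivity
        linarith)
      have e1 : (1 - (1 - σ / r)) * r = σ := by field_simp; ring
      rw [e1] at hb
      refine ⟨_, hV3 _ (h2.trans (hlow _ σ hσ0.le (le_dep hd hcomp hb))), ?_⟩
      have e2 : x - ((1 - σ / r) • x + (1 - (1 - σ / r)) • p) = (σ / r) • (x - p) := by module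
      rw [dist_eq_norm, e2, norm_smul, Real.norm_of_nonneg (by positivity)]
      have : ‖x - p‖ ≤ Λ := by simpa [dist_eq_norm] using hΛ hx
      calc σ / r * ‖x - p‖ ≤ σ / r * Λ := by gcongr
        _ = _ := by ring

lemma exists_s (m : ℕ) : ∃ s : ℝ, 0 < s ∧ s ≤ 1 / 4 ∧ 1 / 2 ≤ (1 - s) ^ m := by
  have h : Tendsto (fun s : ℝ => (1 - s) ^ m) (𝓝[>] 0) (𝓝 1) := by
    have hcont : Continuous (fun s : ℝ => (1 - s) ^ m) := by fun_prop
    have := hcont.tendsto 0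
    simp only [sub_zero, one_pow] at this
    exact this.mono_left nhdsWithin_le_nhds
  have h1 := h.eventually (lt_mem_nhds (show (1 / 2 : ℝ) < 1 by norm_num))
  have h2 : ∀ᶠ s : ℝ in 𝓝[>] 0, s < 1 / 4 :=
    nhdsWithin_le_nhds (gt_mem_nhds (by norm_num))
  obtain ⟨s, hs, hs2, hs3⟩ := (h1.and (h2.and self_mem_nhdsWithin)).exists
  exact ⟨s, hs3, hs2.le, hs.le⟩

lemma B_final (hd : 1 ≤ d) (hcomp : IsCompact Ω) (hc : Convex ℝ Ω) {p : Euc d}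
    (hp : p ∈ interior Ω) {n : ℕ} (hn : 1 ≤ n) :
    ∃ C κ : ℝ, 0 < C ∧ 0 < κ ∧ ∀ᶠ R : ℝ in atTop, ∃ V : Finset (Euc d), V.Nonempty ∧
    faceDim (convexHull ℝ (V : Set (Euc d))) = d ∧
    Metric.hausdorffDist (convexHull ℝ (V : Set (Euc d))) Ω ≤ C * Real.exp (-2 * R * (n / (n + d))) ∧
    κ ≤ (busemannVol (interior Ω) (hilbertBall (interior Ω) p R)).toReal ∧
    κ * (flagSet d (convexHull ℝ (V : Set (Euc d)))).ncard ≤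
      (busemannVol (interior Ω) (hilbertBall (interior Ω) p R)).toReal := by
  have ho := om_pos d
  obtain ⟨r, hr, hpr⟩ := Metric.isOpen_iff.1 isOpen_interior p hp
  have hpr := hpr.trans interior_subset
  obtain ⟨Λ, hΛ1, hΛ⟩ : ∃ Λ : ℝ, 0 < Λ ∧ Ω ⊆ closedBall p Λ := by
    obtain ⟨L, hL⟩ := hcomp.isBounded.subset_closedBall p
    exact ⟨max L 1, by positivity, hL.trans (closedBall_subset_closedBall (le_max_left _ _))⟩
  obtain ⟨s, hs0, hs1, hs⟩ := exists_s (n + d)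
  set F0 := max (volume Ω).toReal 1 with hF0
  have hF1 : 1 ≤ F0 := le_max_right _ _
  set A := 1 + 2 * Λ / r with hA
  have hA0 : 0 < A := by positivity
  set C1 := F0 * (8 * Λ * A) with hC1
  have hC10 : 0 < C1 := by positivity
  set C2 := 2 * C1 ^ n / om d + 1 with hC2
  have hC21 : 1 ≤ C2 := by
    have : 0 < 2 * C1 ^ n / om d := by positivity
    linarith
  set θ : ℝ := n / (n + d) with hθ
  have hn0 : (0 : ℝ) < n := by exact_mod_cast hn
  have hd0 : (0 : ℝ) < d := by exact_mod_cast hd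
  have hθ0 : 0 < θ := by positivity
  set q : ℝ := (2 ^ ⌊(8 * TT d ^ 2 / (s / 8)) ^ d⌋₊) ^ d with hq
  have hq1 : 1 ≤ q := by
    rw [hq]
    apply one_le_pow₀
    apply one_le_pow₀
    norm_num
  set k0 := om d * (s / 8 / 16) ^ d with hk0
  have hk00 : 0 < k0 := by positivity
  have texp : ∀ a : ℝ, 0 < a → Tendsto (fun R : ℝ => Real.exp (-a * R)) atTop (𝓝 0) := by
    intro a ha
    apply Real.tendsto_exp_atBot.comp
    exact tendsto_id.const_mul_atTop_of_neg (by linarith)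
  have ev1 : ∀ᶠ R : ℝ in atTop, 2 * A * Real.exp (-2 * R) < 1 := by
    have := (texp 2 two_pos).const_mul (2 * A)
    rw [mul_zero] at this
    exact this.eventually (gt_mem_nhds one_pos)
  have ev2 : ∀ᶠ R : ℝ in atTop, 4 * (C1 * Real.exp (-2 * R)) ^ n < r ^ (n + d) * om d := by
    have := (((texp 2 two_pos).const_mul C1).pow n).const_mul 4
    rw [mul_zero, zero_pow (by omega), mul_zero] at this
    exact this.eventually (gt_mem_nhds (by positivity))
  have ev3 : ∀ᶠ R : ℝ in atTop, C2 * Real.exp (-(2 * θ) * R) < r := by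
    have := (texp (2 * θ) (by positivity)).const_mul C2
    rw [mul_zero] at this
    exact this.eventually (gt_mem_nhds hr)
  refine ⟨C2 * Λ / r, k0 / q, by positivity, by positivity, ?_⟩
  filter_upwards [ev1, ev2, ev3, eventually_ge_atTop 0] with R h1 h2 h3 h4
  have hE : 0 < Real.exp (-2 * R) := Real.exp_pos _
  obtain ⟨V, v1, v2, v3, v4, v5⟩ := B_core hd hcomp hc hr hpr h4 hΛ hn hs0 hs1 hs (F0 := F0)
    (ρ := 8 * Λ * A * Real.exp (-2 * R)) (σ := C2 * Real.exp (-(2 * θ) * R))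
    hF1 (le_max_left _ _) (by positivity) (by
      have e1 : Real.exp (2 * R) * Real.exp (-2 * R) = 1 := by
        rw [← Real.exp_add]; simp
      have e2 : (1 + 2 * Λ / r) * (1 + 2 * Λ / (8 * Λ * A * Real.exp (-2 * R) / 2)) ≤ Real.exp (2 * R) := by
        rw [← hA]
        have e3 : 2 * Λ / (8 * Λ * A * Real.exp (-2 * R) / 2) = Real.exp (2 * R) / (2 * A) := by
          rw [div_eq_div_iff (by positivity) (by positivity)]
          calc 2 * Λ * (2 * A) = (4 * Λ * A) * 1 := by ring
            _ = _ := by rw [← e1]; ring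
        rw [e3]
        have e4 : A * (1 + Real.exp (2 * R) / (2 * A)) = A + Real.exp (2 * R) / 2 := by
          field_simp
        rw [e4]
        have : 2 * A ≤ Real.exp (2 * R) := by
          have := mul_le_mul_of_nonneg_left h1.le (Real.exp_pos (2 * R)).le
          nlinarith
        linarith
      have := Real.log_le_log (by positivity) e2
      rw [Real.log_exp] at this
      linarith) (by
      have : F0 * (8 * Λ * A * Real.exp (-2 * R)) = C1 * Real.exp (-2 * R) := by rw [hC1]; ring
      rw [this]; exact h2.le) (by positivity) h3.le (by
      have : F0 * (8 * Λ * A * Real.exp (-2 * R)) = C1 * Real.exp (-2 * R) := by rw [hC1]; ring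
      rw [this, mul_pow C1, mul_pow C2, ← Real.exp_nat_mul, ← Real.exp_nat_mul]
      have e5 : ((n + d : ℕ) : ℝ) * (-(2 * θ) * R) = n * (-2 * R) := by
        rw [hθ]; push_cast; field_simp
      rw [e5]
      have e6 : 2 * C1 ^ n ≤ C2 ^ (n + d) * om d := by
        have : C2 ≤ C2 ^ (n + d) := le_self_pow₀ hC21 (by omega)
        calc 2 * C1 ^ n = (2 * C1 ^ n / om d) * om d := by field_simp
          _ ≤ C2 ^ (n + d) * om d := by
            gcongr
            linarith
      have := mul_le_mul_of_nonneg_right e6 (Real.exp_pos (n * (-2 * R))).le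
      linarith)
  refine ⟨V, v1, v2, ?_, ?_, ?_⟩
  · refine v3.trans (le_of_eq ?_)
    rw [show -(2 * θ) * R = -2 * R * θ by ring]
    ring
  · have hV1 : (1 : ℝ) ≤ V.card := by exact_mod_cast v1.card_pos
    calc k0 / q ≤ k0 := div_le_self hk00.le hq1
      _ ≤ V.card * k0 := by nlinarith
      _ ≤ _ := v4
  · refine le_trans ?_ v4
    have v5' : ((flagSet d (convexHull ℝ (V : Set (Euc d)))).ncard : ℝ) ≤ V.card * q := by
      rw [hq]; exact_mod_cast v5
    calc k0 / q * ((flagSet d (convexHull ℝ (V : Set (Euc d)))).ncard : ℝ) ≤ k0 / q * (V.card * q) := by gcongr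
      _ = V.card * k0 := by field_simp

end UpperN


section Approx
variable {d : ℕ} {Ω P : Set (Euc d)}

lemma haus_left (hΩ : IsCompact Ω) (hΩn : Ω.Nonempty) (hP : IsCompact P) (hPn : P.Nonempty) {ε : ℝ}
    (h : hausdorffDist P Ω ≤ ε) {x : Euc d} (hx : x ∈ P) : ∃ y ∈ Ω, dist x y ≤ ε := by
  have hfin : hausdorffEDist P Ω ≠ ⊤ :=
    hausdorffEDist_ne_top_of_nonempty_of_bounded hPn hΩn hP.isBounded hΩ.isBounded
  have h1 := infDist_le_hausdorffDist_of_mem hx hfin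
  obtain ⟨y, hy, hy2⟩ := hΩ.exists_infDist_eq_dist hΩn x
  exact ⟨y, hy, by rw [← hy2]; linarith⟩

lemma approx_ball (hΩ : IsCompact Ω) (hΩn : Ω.Nonempty) (hP : IsCompact P) (hPn : P.Nonempty)
    (hPc : Convex ℝ P) {ε ρ : ℝ} (h : hausdorffDist P Ω ≤ ε) (hρ : 0 < ρ) (hε : ε < ρ / 2)
    {x : Euc d} (hx : ball x ρ ⊆ Ω) : ball x (ρ / 2) ⊆ P := by
  intro y hy
  by_contra hyP
  obtain ⟨f, u, hf1, hf2⟩ := geometric_hahn_banach_closed_point hPc hP.isClosed hyP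
  set g := (InnerProductSpace.toDual ℝ (Euc d)).symm f with hg
  have hfg : ∀ v, f v = ⟪g, v⟫ := fun v => by
    rw [hg, InnerProductSpace.toDual_symm_apply]
  obtain ⟨z0, hz0⟩ := hPn
  have hg0 : g ≠ 0 := by
    intro h0
    have a := hf1 z0 hz0
    rw [hfg, h0, inner_zero_left] at a
    rw [hfg, h0, inner_zero_left] at hf2
    linarith
  have hgn : 0 < ‖g‖ := norm_pos_iff.2 hg0
  set w := y + (ρ / 2 / ‖g‖) • g with hw
  have hwn : ‖(ρ / 2 / ‖g‖) • g‖ = ρ / 2 := by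
    rw [norm_smul, Real.norm_of_nonneg (by positivity)]; field_simp
  have hwΩ : w ∈ Ω := by
    apply hx
    rw [mem_ball, dist_eq_norm] at hy ⊢
    calc ‖w - x‖ = ‖(y - x) + (ρ / 2 / ‖g‖) • g‖ := by rw [hw]; abel_nf
      _ ≤ ‖y - x‖ + ‖(ρ / 2 / ‖g‖) • g‖ := norm_add_le _ _
      _ < ρ := by rw [hwn]; linarith
  obtain ⟨z, hz, hzw⟩ := haus_left (ε := ε) hP ⟨z0, hz0⟩ hΩ hΩn (by rwa [hausdorffDist_comm]) hwΩ
  have h1 := hf1 z hz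
  have h2 : f (w - z) = f y - f z + ρ / 2 * ‖g‖ := by
    rw [hw, map_sub, map_add, map_smul, hfg g, real_inner_self_eq_norm_sq, smul_eq_mul]
    field_simp
    ring
  have h3 : f (w - z) ≤ ‖g‖ * ‖w - z‖ := by rw [hfg]; exact real_inner_le_norm _ _
  rw [dist_eq_norm] at hzw
  nlinarith

lemma approx_mac (hΩ : IsCompact Ω) (hΩn : Ω.Nonempty) (hΩc : Convex ℝ Ω) (hP : IsCompact P)
    (hPn : P.Nonempty)
    {ε ρ : ℝ} (h : hausdorffDist P Ω ≤ ε) (hε : ε < ρ)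
    {x : Euc d} (hx : ball x ρ ⊆ Ω) : (1 / 2 : ℝ) • Mac P x ⊆ Mac Ω x := by
  have key : ∀ z, x + z ∈ P → x + (1 / 2 : ℝ) • z ∈ Ω := by
    intro z hz
    obtain ⟨w, hw, hwd⟩ := haus_left hΩ hΩn hP hPn h hz
    have h1 : x + (x + z - w) ∈ Ω := by
      apply hx
      rw [mem_ball, dist_eq_norm]
      rw [dist_eq_norm] at hwd
      have : x + (x + z - w) - x = x + z - w := by abel
      rw [this]; linarith
    have := hΩc hw h1 (a := 1 / 2) (b := 1 / 2) (by norm_num) (by norm_num) (by norm_num)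
    convert this using 1
    module
  rintro _ ⟨z, ⟨hz1, hz2⟩, rfl⟩
  refine ⟨key z hz1, ?_⟩
  have := key (-z) (by rw [← sub_eq_add_neg]; exact hz2)
  rw [smul_neg, ← sub_eq_add_neg] at this
  exact this

lemma center_finite (hd : 1 ≤ d) {F : Set (Euc d)} (hFc : Convex ℝ F) (I : Finset (Euc d))
    (hI : I.Nonempty) (hIF : ∀ z ∈ I, z ∈ F)
    (hcard : I.card ≤ d + 1) :
    ∃ c ∈ F, ∀ z ∈ I, c + (1 / d : ℝ) • (c - z) ∈ F := by
  have hk : (0 : ℝ) < I.card := by exact_mod_cast hI.card_pos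
  have hd0 : (0 : ℝ) < d := by exact_mod_cast hd
  refine ⟨∑ z ∈ I, (1 / I.card : ℝ) • z, ?_, fun j hj => ?_⟩
  · apply hFc.sum_mem (fun _ _ => by positivity) _ hIF
    rw [Finset.sum_const, nsmul_eq_mul]; field_simp
  · have hcr : (I.card : ℝ) ≤ d + 1 := by exact_mod_cast hcard
    have e : (∑ z ∈ I, (1 / I.card : ℝ) • z) + (1 / d : ℝ) • ((∑ z ∈ I, (1 / I.card : ℝ) • z) - j)
        = ∑ z ∈ I, (((d + 1) / (d * I.card) : ℝ) - if z = j then (1 / d : ℝ) else 0) • z := by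
      simp only [sub_smul, Finset.sum_sub_distrib, ite_smul, zero_smul]
      rw [Finset.sum_ite_eq' I j, if_pos hj, ← Finset.smul_sum, ← Finset.smul_sum]
      have : ((d + 1) / (d * I.card) : ℝ) = (1 + 1 / d) * (1 / I.card) := by field_simp
      rw [this]
      module
    rw [e]
    apply hFc.sum_mem _ _ hIF
    · intro z _
      split_ifs
      · have : (1 / d : ℝ) = (I.card : ℝ) / (d * I.card) := by field_simp
        rw [this, ← sub_div]
        apply div_nonneg <;> [linarith; positivity]
      · rw [sub_zero]; positivity
    · rw [Finset.sum_sub_distrib, Finset.sum_ite_eq' I j, if_pos hj, Finset.sum_const, nsmul_eq_mul]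
      field_simp
      ring

lemma exists_center (hd : 1 ≤ d) {F : Set (Euc d)} (hFn : F.Nonempty) (hF : IsCompact F)
    (hFc : Convex ℝ F) :
    ∃ c ∈ F, ∀ z ∈ F, c + (1 / d : ℝ) • (c - z) ∈ F := by
  let K : F → Set (Euc d) := fun z => F ∩ (fun c => c + (1 / d : ℝ) • (c - (z : Euc d))) ⁻¹' F
  have hd0 : (0 : ℝ) < d := by exact_mod_cast hd
  have hne : (⋂ z, K z).Nonempty := by
    apply Convex.helly_theorem_compact' (𝕜 := ℝ)
    · intro z
      apply hFc.inter
      intro a ha b hb α β hα hβ hαβ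
      have := hFc ha hb hα hβ hαβ
      show _ ∈ F
      have e : α • a + β • b + (1 / d : ℝ) • (α • a + β • b - (z : Euc d))
          = α • (a + (1 / d : ℝ) • (a - (z : Euc d))) + β • (b + (1 / d : ℝ) • (b - (z : Euc d))) := by
        have hβ' : β = 1 - α := by linarith
        rw [hβ']
        module
      show α • a + β • b + (1 / d : ℝ) • (α • a + β • b - (z : Euc d)) ∈ F
      rw [e]
      exact this
    · intro z
      apply hF.inter_right
      exact hF.isClosed.preimage (by fun_prop)
    · intro I hI
      rw [finrank_euclideanSpace_fin] at hI
      rcases I.eq_empty_or_nonempty with rfl | hIn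
      · simp
      obtain ⟨c, hc, hc2⟩ := center_finite hd hFc (I.image Subtype.val) (hIn.image _)
        (by intro z hz; obtain ⟨w, _, rfl⟩ := Finset.mem_image.1 hz; exact w.2)
        (Finset.card_image_le.trans hI)
      refine ⟨c, ?_⟩
      simp only [mem_iInter]
      intro z hz
      exact ⟨hc, hc2 z (Finset.mem_image_of_mem _ hz)⟩
  obtain ⟨c, hc⟩ := hne
  rw [mem_iInter] at hc
  obtain ⟨z0, hz0⟩ := hFn
  exact ⟨c, (hc ⟨z0, hz0⟩).1, fun z hz => (hc ⟨z, hz⟩).2⟩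

/-- a central point of a compact convex set -/
def ctr (F : Set (Euc d)) : Euc d :=
  if h : ∃ c ∈ F, ∀ z ∈ F, c + (1 / d : ℝ) • (c - z) ∈ F then h.choose else 0

lemma ctr_mem (hd : 1 ≤ d) {F : Set (Euc d)} (hFn : F.Nonempty) (hF : IsCompact F)
    (hFc : Convex ℝ F) : ctr F ∈ F := by
  have h := exists_center hd hFn hF hFc
  rw [ctr, dif_pos h]
  exact h.choose_spec.1

lemma ctr_refl (hd : 1 ≤ d) {F : Set (Euc d)} (hFn : F.Nonempty) (hF : IsCompact F)
    (hFc : Convex ℝ F) {z : Euc d} (hz : z ∈ F) : ctr F + (1 / d : ℝ) • (ctr F - z) ∈ F := by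
  have h := exists_center hd hFn hF hFc
  rw [ctr, dif_pos h]
  exact h.choose_spec.2 z hz

end Approx


section Cover
variable {d : ℕ}

lemma intrinsic_extend {F : Set (Euc d)} {m x : Euc d} (hm : m ∈ intrinsicInterior ℝ F)
    (hx : x ∈ affineSpan ℝ F) : ∃ s : ℝ, 0 < s ∧ m + s • (m - x) ∈ F := by
  obtain ⟨y, hy, rfl⟩ := mem_intrinsicInterior.1 hm
  have hmem : ∀ s : ℝ, (y : Euc d) + s • ((y : Euc d) - x) ∈ affineSpan ℝ F := by
    intro s
    have := AffineMap.lineMap_mem (-s) y.2 hx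
    rw [AffineMap.lineMap_apply] at this
    convert this using 1
    simp only [vsub_eq_sub, vadd_eq_add]
    module
  let φ : ℝ → affineSpan ℝ F := fun s => ⟨(y : Euc d) + s • ((y : Euc d) - x), hmem s⟩
  have hφ : Continuous φ := by
    apply Continuous.subtype_mk
    fun_prop
  have hφ0 : φ 0 = y := by ext1; simp [φ]
  have ht : Tendsto φ (𝓝[>] 0) (𝓝 y) := by
    have := hφ.tendsto 0
    rw [hφ0] at this
    exact this.mono_left nhdsWithin_le_nhds
  have hev := ht.eventually (mem_interior_iff_mem_nhds.1 hy)
  obtain ⟨s, hs, hs0⟩ := (hev.and self_mem_nhdsWithin).exists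
  exact ⟨s, hs0, hs⟩

lemma mem_openSegment_extend {m x : Euc d} {s : ℝ} (hs : 0 < s) :
    m ∈ openSegment ℝ x (m + s • (m - x)) := by
  refine ⟨s / (1 + s), 1 / (1 + s), by positivity, by positivity, ?_, ?_⟩
  · field_simp; ring
  · have e : m + s • (m - x) = (1 + s) • m - s • x := by module
    rw [e, smul_sub, smul_smul, smul_smul, one_div_mul_cancel (by positivity), one_smul,
      one_div_mul_eq_div]
    abel

lemma faceDim_mono {F F' : Set (Euc d)} (hsub : F ⊆ F') : faceDim F ≤ faceDim F' :=
  Submodule.finrank_mono (AffineSubspace.direction_le (affineSpan_mono ℝ hsub))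

lemma face_eq_of_dim {P F F' : Set (Euc d)} (hF : IsFace P F) (hF' : F' ⊆ P) (hsub : F ⊆ F')
    (hdim : faceDim F = faceDim F') : F = F' := by
  have hle : affineSpan ℝ F ≤ affineSpan ℝ F' := affineSpan_mono ℝ hsub
  have hdir : (affineSpan ℝ F).direction = (affineSpan ℝ F').direction :=
    Submodule.eq_of_le_of_finrank_eq (AffineSubspace.direction_le hle) hdim
  have heq : affineSpan ℝ F = affineSpan ℝ F' :=
    AffineSubspace.eq_of_direction_eq_of_nonempty_of_le hdir ((affineSpan_nonempty ℝ).2 hF.1) hle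
  refine subset_antisymm hsub fun x hx => ?_
  obtain ⟨m, hm⟩ := hF.1.intrinsicInterior hF.2.2.1
  have hxs : x ∈ affineSpan ℝ F := by rw [heq]; exact subset_affineSpan ℝ _ hx
  obtain ⟨s, hs, hms⟩ := intrinsic_extend hm hxs
  exact extreme_left hF.2.2.2 (hF' hx) (hF.2.2.2.subset hms) (intrinsicInterior_subset hm)
    (mem_openSegment_extend hs)

/-- The smallest face through `y`. -/
def miniFace (F : Set (Euc d)) (y : Euc d) : Set (Euc d) := {z ∈ F | ∃ s : ℝ, 0 < s ∧ y + s • (y - z) ∈ F}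

lemma shrink_mem {F : Set (Euc d)} (hF : Convex ℝ F) {y z : Euc d} (hy : y ∈ F) {s s' : ℝ} (hs' : 0 < s')
    (hss : s' ≤ s) (h : y + s • (y - z) ∈ F) : y + s' • (y - z) ∈ F := by
  have hs : 0 < s := by linarith
  have := hF h hy (a := s' / s) (b := 1 - s' / s) (by positivity)
    (by rw [sub_nonneg, div_le_one hs]; exact hss) (by ring)
  convert this using 1
  have : s' = (s' / s) * s := by field_simp
  nth_rewrite 1 [this]
  module

lemma miniFace_convex {F : Set (Euc d)} (hF : Convex ℝ F) {y : Euc d} (hy : y ∈ F) :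
    Convex ℝ (miniFace F y) := by
  rintro a ⟨ha, s, hs, has⟩ b ⟨hb, t, ht, hbt⟩ α β hα hβ hαβ
  refine ⟨hF ha hb hα hβ hαβ, min s t, lt_min hs ht, ?_⟩
  have h1 := shrink_mem hF hy (lt_min hs ht) (min_le_left s t) has
  have h2 := shrink_mem hF hy (lt_min hs ht) (min_le_right s t) hbt
  have := hF h1 h2 hα hβ hαβ
  convert this using 1
  have hβ' : β = 1 - α := by linarith
  rw [hβ']
  module

lemma miniFace_extreme {P F : Set (Euc d)} (hF : Convex ℝ F) (hex : IsExtreme ℝ P F) {y : Euc d} :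
    IsExtreme ℝ P (miniFace F y) := by
  refine ⟨fun z hz => hex.subset hz.1, ?_⟩
  rintro a ha b hb z ⟨hz, s, hs, hzs⟩ hzab
  have haF : a ∈ F := hex.left_mem_of_mem_openSegment ha hb hz hzab
  have hbF : b ∈ F := hex.right_mem_of_mem_openSegment ha hb hz hzab
  obtain ⟨α, β, hα, hβ, hαβ, rfl⟩ := hzab
  refine ⟨haF, s * α / (1 + s * β), by positivity, ?_⟩
  set u := y + s • (y - (α • a + β • b)) with hu
  have := hF hzs hbF (a := 1 / (1 + s * β)) (b := s * β / (1 + s * β)) (by positivity) (by positivity)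
    (by field_simp)
  convert this using 1
  have hy : (1 + s) • y = u + (s * α) • a + (s * β) • b := by rw [hu]; module
  have e1 : y + (s * α / (1 + s * β)) • (y - a)
      = (1 / (1 + s * β)) • ((1 + s) • y) - (s * α / (1 + s * β)) • a := by
    have hh : (1 + s * α / (1 + s * β)) = 1 / (1 + s * β) * (1 + s) := by
      have hα' : α = 1 - β := by linarith
      rw [hα']; field_simp; ring
    rw [smul_smul, ← hh]
    module
  rw [e1, hy]
  have e2 : s * α / (1 + s * β) = 1 / (1 + s * β) * (s * α) := by ring
  have e3 : s * β / (1 + s * β) = 1 / (1 + s * β) * (s * β) := by ring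
  rw [e2, e3]
  module

lemma mem_miniFace {F : Set (Euc d)} {y : Euc d} (hy : y ∈ F) : y ∈ miniFace F y :=
  ⟨hy, 1, one_pos, by simpa using hy⟩

lemma poly_compact (V : Finset (Euc d)) : IsCompact (convexHull ℝ (V : Set (Euc d))) :=
  V.finite_toSet.isCompact_convexHull ℝ

lemma face_compact {V : Finset (Euc d)} {F : Set (Euc d)} (hF : IsFace (convexHull ℝ (V : Set (Euc d))) F) :
    IsCompact F := (poly_compact V).of_isClosed_subset hF.2.1 hF.2.2.2.subset

lemma miniFace_isFace {V : Finset (Euc d)} {F : Set (Euc d)}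
    (hF : IsFace (convexHull ℝ (V : Set (Euc d))) F) {y : Euc d} (hy : y ∈ F) :
    IsFace (convexHull ℝ (V : Set (Euc d))) (miniFace F y) := by
  have h1 := miniFace_convex hF.2.2.1 hy
  have h2 := miniFace_extreme hF.2.2.1 hF.2.2.2 (y := y)
  refine ⟨⟨y, mem_miniFace hy⟩, ?_, h1, h2⟩
  rw [face_hull h1 h2]
  exact (poly_compact _).isClosed

lemma exit_point {F : Set (Euc d)} (hF : IsCompact F) {c x : Euc d} (hx : x ∈ F)
    (hne : x ≠ c) : ∃ s : ℝ, 1 ≤ s ∧ c + s • (x - c) ∈ F ∧ ∀ s' > s, c + s' • (x - c) ∉ F := by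
  have hn : 0 < ‖x - c‖ := norm_pos_iff.2 (sub_ne_zero.2 hne)
  let T : Set ℝ := {s | 1 ≤ s ∧ c + s • (x - c) ∈ F}
  have hT1 : (1 : ℝ) ∈ T := ⟨le_rfl, by simpa using hx⟩
  have hTcl : IsClosed T :=
    isClosed_Ici.inter (hF.isClosed.preimage (f := fun s : ℝ => c + s • (x - c)) (by fun_prop))
  obtain ⟨L, hL⟩ := hF.isBounded.subset_closedBall c
  have hTb : BddAbove T := by
    refine ⟨L / ‖x - c‖, fun s hs => ?_⟩
    have h1 := hL hs.2
    rw [mem_closedBall, dist_eq_norm, add_sub_cancel_left, norm_smul,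
      Real.norm_of_nonneg (by linarith [hs.1])] at h1
    rwa [le_div_iff₀ hn]
  have hmem := hTcl.csSup_mem ⟨1, hT1⟩ hTb
  refine ⟨sSup T, hmem.1, hmem.2, fun s' hs' hcon => ?_⟩
  have := le_csSup hTb (show s' ∈ T from ⟨by linarith [hmem.1], hcon⟩)
  linarith

lemma cover_chain (hd : 1 ≤ d) {V : Finset (Euc d)} (k : ℕ) :
    ∀ F : Set (Euc d), IsFace (convexHull ℝ (V : Set (Euc d))) F → faceDim F ≤ k → ∀ x ∈ F,
    ∃ C : Finset (Set (Euc d)), (∀ G ∈ C, IsFace (convexHull ℝ (V : Set (Euc d))) G ∧ G ⊆ F) ∧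
      (∀ G ∈ C, ∀ G' ∈ C, G ⊆ G' ∨ G' ⊆ G) ∧ x ∈ convexHull ℝ (ctr '' (C : Set (Set (Euc d)))) := by
  induction k with
  | zero =>
    intro F hF hk x hx
    have hcm := ctr_mem hd hF.1 (face_compact hF) hF.2.2.1
    by_cases hxc : x = ctr F
    · refine ⟨{F}, by simp [hF], by simp, ?_⟩
      rw [hxc]; simp
    exfalso
    have h1 : Module.finrank ℝ (affineSpan ℝ F).direction = 0 := by
      have : faceDim F = 0 := by omega
      exact this
    rw [Submodule.finrank_eq_zero] at h1
    have h2 : x -ᵥ ctr F ∈ (affineSpan ℝ F).direction :=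
      AffineSubspace.vsub_mem_direction (subset_affineSpan ℝ _ hx) (subset_affineSpan ℝ _ hcm)
    rw [h1, Submodule.mem_bot, vsub_eq_zero_iff_eq] at h2
    exact hxc h2
  | succ k ih =>
    intro F hF hk x hx
    have hcm := ctr_mem hd hF.1 (face_compact hF) hF.2.2.1
    by_cases hxc : x = ctr F
    · refine ⟨{F}, by simp [hF], by simp, ?_⟩
      rw [hxc]; simp
    obtain ⟨s, hs1, hsF, hsmax⟩ := exit_point (face_compact hF) hx hxc
    set y := ctr F + s • (x - ctr F) with hy
    have hG := miniFace_isFace hF hsF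
    have hGF : miniFace F y ⊆ F := fun z hz => hz.1
    have hcG : ctr F ∉ miniFace F y := by
      rintro ⟨-, t, ht, h⟩
      refine hsmax ((1 + t) * s) (by nlinarith) ?_
      convert h using 1
      rw [hy]; module
    have hlt : faceDim (miniFace F y) < faceDim F := by
      refine lt_of_le_of_ne (faceDim_mono hGF) fun heq => ?_
      have := face_eq_of_dim hG hF.2.2.2.subset hGF heq
      rw [this] at hcG
      exact hcG hcm
    obtain ⟨C, hC1, hC2, hC3⟩ := ih (miniFace F y) hG (by omega) y (mem_miniFace hsF)
    refine ⟨insert F C, ?_, ?_, ?_⟩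
    · intro G hGC
      rcases Finset.mem_insert.1 hGC with rfl | h
      · exact ⟨hF, subset_rfl⟩
      · exact ⟨(hC1 G h).1, (hC1 G h).2.trans hGF⟩
    · intro G hGC G' hGC'
      rcases Finset.mem_insert.1 hGC with rfl | h
      · rcases Finset.mem_insert.1 hGC' with rfl | h'
        · exact Or.inl subset_rfl
        · exact Or.inr ((hC1 G' h').2.trans hGF)
      · rcases Finset.mem_insert.1 hGC' with rfl | h'
        · exact Or.inl ((hC1 G h).2.trans hGF)
        · exact hC2 G h G' h'
    · have hcv := convex_convexHull ℝ (ctr '' ((insert F C : Finset (Set (Euc d))) : Set (Set (Euc d))))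
      have a1 : ctr F ∈ convexHull ℝ (ctr '' ((insert F C : Finset (Set (Euc d))) : Set (Set (Euc d)))) :=
        subset_convexHull ℝ _ ⟨F, by simp, rfl⟩
      have a2 : y ∈ convexHull ℝ (ctr '' ((insert F C : Finset (Set (Euc d))) : Set (Set (Euc d)))) :=
        convexHull_mono (image_mono (by simp)) hC3
      have := hcv a1 a2 (a := 1 - 1 / s) (b := 1 / s)
        (by rw [sub_nonneg, div_le_one (by linarith)]; exact hs1) (by positivity) (by ring)
      convert this using 1
      have hs0 : s ≠ 0 := by linarith
      rw [hy, smul_add, smul_smul, one_div_mul_cancel hs0]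
      module

lemma faces_finite (V : Finset (Euc d)) : {F | IsFace (convexHull ℝ (V : Set (Euc d))) F}.Finite := by
  apply Set.Finite.subset (V.powerset.finite_toSet.image
    (fun W : Finset (Euc d) => convexHull ℝ (W : Set (Euc d))))
  intro F hF
  exact ⟨V.filter (· ∈ F), Finset.mem_coe.2 (Finset.mem_powerset.2 (Finset.filter_subset _ _)), (face_hull hF.2.2.1 hF.2.2.2).symm⟩

lemma flags_finite (V : Finset (Euc d)) : (flagSet d (convexHull ℝ (V : Set (Euc d)))).Finite := by
  apply Set.Finite.subset (Set.Finite.pi' (fun _ : Fin (d + 1) => faces_finite V))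
  intro f hf i
  exact (hf.1 i).1

lemma null_span {S : Finset (Euc d)} (h : S.card ≤ d) (hne : S.Nonempty) :
    volume (convexHull ℝ (S : Set (Euc d))) = 0 := by
  have h1 : affineSpan ℝ (S : Set (Euc d)) ≠ ⊤ := by
    intro htop
    have h2 := finrank_vectorSpan_image_finset_le ℝ (id : Euc d → Euc d) S (n := S.card - 1)
      (by have := hne.card_pos; omega)
    rw [Finset.image_id, ← direction_affineSpan, htop, AffineSubspace.direction_top, finrank_top,
      finrank_euclideanSpace_fin] at h2
    have := hne.card_pos
    omega
  exact measure_mono_null (convexHull_subset_affineSpan _) (Measure.addHaar_affineSubspace _ _ h1)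

lemma chain_flag {P : Set (Euc d)} {C : Finset (Set (Euc d))} (hC1 : ∀ G ∈ C, IsFace P G)
    (hC2 : ∀ G ∈ C, ∀ G' ∈ C, G ⊆ G' ∨ G' ⊆ G) (hcard : d < C.card) :
    ∃ f ∈ flagSet d P, ∀ G ∈ C, G ∈ range f := by
  have hinj : Set.InjOn faceDim (C : Set (Set (Euc d))) := by
    intro G hG G' hG' heq
    rcases hC2 G hG G' hG' with h | h
    · exact face_eq_of_dim (hC1 G hG) (hC1 G' hG').2.2.2.subset h heq
    · exact (face_eq_of_dim (hC1 G' hG') (hC1 G hG).2.2.2.subset h heq.symm).symm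
  have hle : ∀ F : Set (Euc d), faceDim F ≤ d := by
    intro F
    have := Submodule.finrank_le (affineSpan ℝ F).direction
    rwa [finrank_euclideanSpace_fin] at this
  have himg : C.image faceDim = Finset.range (d + 1) := by
    apply Finset.eq_of_subset_of_card_le
    · intro k hk
      obtain ⟨G, _, rfl⟩ := Finset.mem_image.1 hk
      exact Finset.mem_range.2 (Nat.lt_succ_of_le (hle G))
    · rw [Finset.card_image_of_injOn hinj, Finset.card_range]
      exact hcard
  have hex : ∀ i : Fin (d + 1), ∃ G ∈ C, faceDim G = i := by
    intro i
    have : (i : ℕ) ∈ C.image faceDim := by rw [himg]; exact Finset.mem_range.2 i.2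
    exact Finset.mem_image.1 this
  choose f hfC hfd using hex
  refine ⟨f, ⟨fun i => ⟨hC1 _ (hfC i), hfd i⟩, ?_⟩, ?_⟩
  · intro i j hij
    rcases hC2 _ (hfC i) _ (hfC j) with h | h
    · exact h
    · have h1 := faceDim_mono h
      rw [hfd, hfd] at h1
      have : i = j := le_antisymm hij h1
      rw [this]
  · intro G hG
    refine ⟨⟨faceDim G, Nat.lt_succ_of_le (hle G)⟩, ?_⟩
    exact hinj (hfC _) hG (hfd _)

lemma cover_flags (hd : 1 ≤ d) {V : Finset (Euc d)} (hV : V.Nonempty) :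
    ∃ N : Set (Euc d), volume N = 0 ∧ ∀ x ∈ convexHull ℝ (V : Set (Euc d)), x ∈ N ∨
      ∃ f ∈ flagSet d (convexHull ℝ (V : Set (Euc d))), x ∈ convexHull ℝ (range fun i => ctr (f i)) := by
  set P := convexHull ℝ (V : Set (Euc d)) with hP
  have hPf : IsFace P P := ⟨by rw [hP, convexHull_nonempty_iff]; exact hV,
    (poly_compact V).isClosed, convex_convexHull ℝ _, IsExtreme.rfl⟩
  let 𝓒 : Set (Finset (Set (Euc d))) := {C | (∀ G ∈ C, IsFace P G) ∧ C.Nonempty ∧ C.card ≤ d}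
  have h𝓒 : 𝓒.Finite := by
    apply Set.Finite.subset ((faces_finite V).toFinset.powerset.finite_toSet)
    intro C hC
    simp only [Finset.coe_powerset, mem_preimage, mem_powerset_iff]
    intro G hG
    simpa using hC.1 G hG
  refine ⟨⋃ C ∈ 𝓒, convexHull ℝ (ctr '' (C : Set (Set (Euc d)))), ?_, ?_⟩
  · rw [measure_biUnion_null_iff h𝓒.countable]
    intro C hC
    rw [← Finset.coe_image]
    exact null_span (Finset.card_image_le.trans hC.2.2) (hC.2.1.image _)
  · intro x hx
    obtain ⟨C, hC1, hC2, hC3⟩ := cover_chain hd (faceDim P) P hPf le_rfl x hx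
    by_cases hcard : C.card ≤ d
    · left
      rw [mem_iUnion₂]
      refine ⟨C, ⟨fun G hG => (hC1 G hG).1, ?_, hcard⟩, hC3⟩
      have : (convexHull ℝ (ctr '' (C : Set (Set (Euc d))))).Nonempty := ⟨x, hC3⟩
      rw [convexHull_nonempty_iff, image_nonempty] at this
      exact this
    · right
      obtain ⟨f, hf, hfC⟩ := chain_flag (fun G hG => (hC1 G hG).1) hC2 (not_le.1 hcard)
      refine ⟨f, hf, convexHull_mono ?_ hC3⟩
      rintro _ ⟨G, hG, rfl⟩
      obtain ⟨i, rfl⟩ := hfC G hG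
      exact ⟨i, rfl⟩

end Cover


section FlagEst
variable {d : ℕ}

lemma hull_range_weights {m : ℕ} (v : Fin m → Euc d) {x : Euc d} (hx : x ∈ convexHull ℝ (range v)) :
    ∃ w : Fin m → ℝ, (∀ i, 0 ≤ w i) ∧ ∑ i, w i = 1 ∧ x = ∑ i, w i • v i := by
  let S : Set (Euc d) := {x | ∃ w : Fin m → ℝ, (∀ i, 0 ≤ w i) ∧ ∑ i, w i = 1 ∧ x = ∑ i, w i • v i}
  have hS : Convex ℝ S := by
    rintro a ⟨w, hw0, hw1, rfl⟩ b ⟨u, hu0, hu1, rfl⟩ α β hα hβ hαβ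
    refine ⟨fun i => α * w i + β * u i, fun i => ?_, ?_, ?_⟩
    · have := hw0 i
      have := hu0 i
      positivity
    · rw [Finset.sum_add_distrib, ← Finset.mul_sum, ← Finset.mul_sum, hw1, hu1]; linarith
    · simp only [add_smul, mul_smul, Finset.sum_add_distrib, Finset.smul_sum]
  refine convexHull_min (t := S) ?_ hS hx
  rintro _ ⟨j, rfl⟩
  refine ⟨fun i => if i = j then 1 else 0, fun i => by dsimp only; split_ifs <;> norm_num, by simp, by simp⟩

lemma telescope (xs : Fin (d + 1) → Euc d) (j : Fin (d + 1)) :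
    ∑ i : Fin d, (if i.castSucc < j then xs i.succ - xs i.castSucc else 0) = xs j - xs 0 := by
  induction j using Fin.induction with
  | zero => simp
  | succ k ih =>
    have : ∀ i : Fin d, (if i.castSucc < k.succ then xs i.succ - xs i.castSucc else 0)
        = (if i.castSucc < k.castSucc then xs i.succ - xs i.castSucc else 0)
          + (if i = k then xs i.succ - xs i.castSucc else 0) := by
      intro i
      by_cases h1 : i = k
      · subst h1; simp
      · have h2 : (i.castSucc < k.succ) ↔ (i.castSucc < k.castSucc) := by
          rw [Fin.lt_def, Fin.lt_def]
          simp only [Fin.val_castSucc, Fin.val_succ]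
          have : (i : ℕ) ≠ k := fun h => h1 (Fin.ext h)
          omega
        simp [h1, h2]
    simp_rw [this]
    rw [Finset.sum_add_distrib, ih]
    simp

/-- tail sums of the barycentric coordinates -/
def tails (l : Fin (d + 1) → ℝ) (i : Fin d) : ℝ := ∑ j, if i.castSucc < j then l j else 0

lemma abel_sum (xs : Fin (d + 1) → Euc d) (l : Fin (d + 1) → ℝ) (hl : ∑ j, l j = 1) :
    ∑ j, l j • xs j = xs 0 + ∑ i : Fin d, tails l i • (xs i.succ - xs i.castSucc) := by
  have h1 : ∑ i : Fin d, tails l i • (xs i.succ - xs i.castSucc)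
      = ∑ j, l j • ∑ i : Fin d, (if i.castSucc < j then xs i.succ - xs i.castSucc else 0) := by
    simp only [tails, Finset.sum_smul, Finset.smul_sum]
    rw [Finset.sum_comm]
    refine Finset.sum_congr rfl fun j _ => Finset.sum_congr rfl fun i _ => ?_
    split_ifs <;> simp
  rw [h1]
  simp_rw [telescope, smul_sub]
  rw [Finset.sum_sub_distrib, ← Finset.sum_smul, hl, one_smul]
  abel

lemma tails_le {l : Fin (d + 1) → ℝ} (h0 : ∀ i, 0 ≤ l i) (hl : ∑ j, l j = 1) (i : Fin d) :
    tails l i ≤ 1 := by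
  rw [← hl]
  refine Finset.sum_le_sum fun j _ => ?_
  split_ifs
  · exact le_rfl
  · exact h0 j

lemma le_tails {l : Fin (d + 1) → ℝ} (h0 : ∀ i, 0 ≤ l i) (i : Fin d) :
    l (Fin.last d) ≤ tails l i := by
  have h := Finset.single_le_sum (f := fun j => if i.castSucc < j then l j else 0)
    (fun j _ => by split_ifs; exacts [h0 j, le_rfl]) (Finset.mem_univ (Fin.last d))
  unfold tails
  simpa [Fin.castSucc_lt_last] using h

lemma flag_ctr (hd : 1 ≤ d) {V : Finset (Euc d)} {f : Fin (d + 1) → Set (Euc d)}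
    (hf : f ∈ flagSet d (convexHull ℝ (V : Set (Euc d)))) (i : Fin (d + 1)) : ctr (f i) ∈ f i :=
  ctr_mem hd (hf.1 i).1.1 (face_compact (hf.1 i).1) (hf.1 i).1.2.2.1

lemma flag_dir (hd : 1 ≤ d) {V : Finset (Euc d)} {f : Fin (d + 1) → Set (Euc d)}
    (hf : f ∈ flagSet d (convexHull ℝ (V : Set (Euc d)))) {i : Fin d} {j : Fin (d + 1)}
    (hij : i.castSucc < j) :
    (1 / (2 * d) : ℝ) • (ctr (f i.succ) - ctr (f i.castSucc)) ∈ Mac (f j) (ctr (f j)) := by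
  have hd0 : (1 : ℝ) ≤ d := by exact_mod_cast hd
  have hcv : Convex ℝ (f j) := (hf.1 j).1.2.2.1
  have hij' : i.succ ≤ j := by
    rw [Fin.le_def, Fin.val_succ]
    rw [Fin.lt_def, Fin.val_castSucc] at hij
    omega
  have hj := flag_ctr hd hf j
  have ha : ctr (f i.succ) ∈ f j := hf.2 _ _ hij' (flag_ctr hd hf i.succ)
  have hb : ctr (f i.castSucc) ∈ f j := hf.2 _ _ hij.le (flag_ctr hd hf i.castSucc)
  have key : ∀ a ∈ f j, ∀ b ∈ f j, ctr (f j) + (1 / (2 * d) : ℝ) • (a - b) ∈ f j := by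
    intro a ha b hb
    have h1 : ctr (f j) + (1 / d : ℝ) • (ctr (f j) - b) ∈ f j :=
      ctr_refl hd (hf.1 j).1.1 (face_compact (hf.1 j).1) hcv hb
    have h2 : (1 - 1 / d : ℝ) • ctr (f j) + (1 / d : ℝ) • a ∈ f j := by
      apply hcv hj ha _ (by positivity) (by ring)
      rw [sub_nonneg, div_le_one (by linarith)]; exact hd0
    have := hcv h1 h2 (a := 1 / 2) (b := 1 / 2) (by norm_num) (by norm_num) (by norm_num)
    convert this using 1
    have e : (1 / (2 * d) : ℝ) = 1 / 2 * (1 / d) := by field_simp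
    rw [e]
    module
  refine ⟨key _ ha _ hb, ?_⟩
  have := key _ hb _ ha
  convert this using 1
  module

lemma flag_mac (hd : 1 ≤ d) {V : Finset (Euc d)} {f : Fin (d + 1) → Set (Euc d)}
    (hf : f ∈ flagSet d (convexHull ℝ (V : Set (Euc d)))) {l : Fin (d + 1) → ℝ}
    (h0 : ∀ i, 0 ≤ l i) (hl : ∑ j, l j = 1) (i : Fin d) :
    (tails l i / (2 * d)) • (ctr (f i.succ) - ctr (f i.castSucc))
      ∈ Mac (convexHull ℝ (V : Set (Euc d))) (∑ j, l j • ctr (f j)) := by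
  set w := ctr (f i.succ) - ctr (f i.castSucc) with hw
  set P := convexHull ℝ (V : Set (Euc d)) with hP
  have hcv : Convex ℝ P := convex_convexHull ℝ _
  have hsub : ∀ j, f j ⊆ P := fun j => (hf.1 j).1.2.2.2.subset
  have key : ∀ σ : ℝ, (∀ j, i.castSucc < j → ctr (f j) + σ • w ∈ P) →
      (∑ j, l j • ctr (f j)) + (tails l i * σ) • w ∈ P := by
    intro σ hσ
    have e : (∑ j, l j • ctr (f j)) + (tails l i * σ) • w
        = ∑ j, l j • (if i.castSucc < j then ctr (f j) + σ • w else ctr (f j)) := by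
      simp only [tails, Finset.sum_mul, Finset.sum_smul]
      rw [← Finset.sum_add_distrib]
      refine Finset.sum_congr rfl fun j _ => ?_
      split_ifs
      · rw [smul_add, smul_smul]
      · simp
    rw [e]
    apply hcv.sum_mem (fun j _ => h0 j) hl
    intro j _
    split_ifs with h
    · exact hσ j h
    · exact hsub j (flag_ctr hd hf j)
  constructor
  · have := key (1 / (2 * d)) (fun j hj => hsub j (flag_dir hd hf hj).1)
    rwa [mul_one_div] at this
  · have := key (-(1 / (2 * d))) (fun j hj => by
      rw [neg_smul, ← sub_eq_add_neg]
      exact hsub j (flag_dir hd hf hj).2)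
    rwa [mul_neg, neg_smul, ← sub_eq_add_neg, mul_one_div] at this

lemma flag_last (hd : 1 ≤ d) {V : Finset (Euc d)} {f : Fin (d + 1) → Set (Euc d)}
    (hdim : faceDim (convexHull ℝ (V : Set (Euc d))) = d)
    (hf : f ∈ flagSet d (convexHull ℝ (V : Set (Euc d)))) {l : Fin (d + 1) → ℝ}
    (h0 : ∀ i, 0 ≤ l i) (hl : ∑ j, l j = 1) {δ D : ℝ}
    (hball : ball (∑ j, l j • ctr (f j)) δ ⊆ convexHull ℝ (V : Set (Euc d)))
    (hD : ∀ x ∈ convexHull ℝ (V : Set (Euc d)), ∀ y ∈ convexHull ℝ (V : Set (Euc d)), dist x y ≤ D) :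
    δ ≤ l (Fin.last d) * D := by
  set P := convexHull ℝ (V : Set (Euc d)) with hP
  let m : Fin (d + 1) := ⟨d - 1, by omega⟩
  have hcv : Convex ℝ (f m) := (hf.1 m).1.2.2.1
  have hsub : ∀ j, f j ⊆ P := fun j => (hf.1 j).1.2.2.2.subset
  have hm : ∀ y ∈ f m, y ∉ interior P := by
    intro y hy hyi
    have := extreme_eq_of_interior (hf.1 m).1.2.2.2 hy hyi
    have h2 := (hf.1 m).2
    rw [this, hdim] at h2
    change d = d - 1 at h2
    omega
  have hcast : ∀ j : Fin d, ctr (f j.castSucc) ∈ f m := fun j =>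
    hf.2 _ _ (by rw [Fin.le_def]; change (j : ℕ) ≤ d - 1; omega) (flag_ctr hd hf j.castSucc)
  set ld := l (Fin.last d) with hld
  have hsum : ∑ j : Fin d, l j.castSucc = 1 - ld := by
    rw [Fin.sum_univ_castSucc] at hl; linarith
  have hx := Fin.sum_univ_castSucc (fun j => l j • ctr (f j))
  have hex : ∃ y ∈ f m, ∑ j, l j • ctr (f j) = (1 - ld) • y + ld • ctr (f (Fin.last d)) := by
    have hs0 : 0 ≤ 1 - ld := by rw [← hsum]; exact Finset.sum_nonneg fun j _ => h0 _
    rcases eq_or_lt_of_le hs0 with h | h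
    · refine ⟨ctr (f m), flag_ctr hd hf m, ?_⟩
      have hz : ∀ j : Fin d, l j.castSucc = 0 := by
        rw [← h] at hsum
        intro j
        exact (Finset.sum_eq_zero_iff_of_nonneg (fun j _ => h0 _)).1 hsum j (Finset.mem_univ j)
      rw [hx, ← h]
      simp [hz, hld]
    · refine ⟨∑ j : Fin d, (l j.castSucc / (1 - ld)) • ctr (f j.castSucc), ?_, ?_⟩
      · apply hcv.sum_mem
        · intro j _
          have := h0 j.castSucc
          positivity
        · rw [← Finset.sum_div, hsum, div_self h.ne']
        · exact fun j _ => hcast j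
      · rw [hx, Finset.smul_sum]
        congr 1
        refine Finset.sum_congr rfl fun j _ => ?_
        rw [smul_smul, mul_div_cancel₀ _ h.ne']
  obtain ⟨y, hy, hxy⟩ := hex
  have h1 : δ ≤ dist y (∑ j, l j • ctr (f j)) := by
    by_contra hcon
    exact hm y hy (mem_interior.2 ⟨_, hball, isOpen_ball, mem_ball.2 (not_le.1 hcon)⟩)
  have h2 : y - (∑ j, l j • ctr (f j)) = ld • (y - ctr (f (Fin.last d))) := by
    rw [hxy]; module
  rw [dist_eq_norm, h2, norm_smul, Real.norm_of_nonneg (h0 _), ← dist_eq_norm] at h1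
  refine h1.trans ?_
  have := hD y (hsub m hy) _ (hsub _ (flag_ctr hd hf (Fin.last d)))
  have := h0 (Fin.last d)
  gcongr

/-- symmetric box spanned by the vectors `w` -/
def sbox (w : Fin d → Euc d) (s : Fin d → ℝ) : Set (Euc d) :=
  (fun a : Fin d → ℝ => ∑ i, a i • w i) '' Set.pi univ (fun i => Icc (-s i) (s i))

lemma sbox_compact (w : Fin d → Euc d) (s : Fin d → ℝ) : IsCompact (sbox w s) :=
  (isCompact_univ_pi fun _ => isCompact_Icc).image (by fun_prop)

lemma sbox_mac (hd : 1 ≤ d) {P : Set (Euc d)} (hP : Convex ℝ P) {x : Euc d} {w : Fin d → Euc d}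
    {μ s : Fin d → ℝ} (hμ : ∀ i, 0 < μ i) (hmac : ∀ i, (μ i / (2 * d)) • w i ∈ Mac P x)
    (hs : ∀ i, s i ≤ μ i / (2 * d ^ 2)) : sbox w s ⊆ Mac P x := by
  have hd0 : (0 : ℝ) < d := by exact_mod_cast hd
  rintro _ ⟨a, ha, rfl⟩
  have e : (fun a : Fin d → ℝ => ∑ i, a i • w i) a
      = ∑ i, (1 / d : ℝ) • ((a i * (2 * d ^ 2) / μ i) • ((μ i / (2 * d)) • w i)) := by
    refine Finset.sum_congr rfl fun i _ => ?_
    have := (hμ i).ne'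
    rw [smul_smul, smul_smul]
    congr 1
    field_simp
  rw [e]
  apply (mac_convex hP x).sum_mem (fun i _ => by positivity)
  · simp [hd0.ne']
  · intro i _
    have hai := ha i (mem_univ i)
    have h1 := hs i
    rw [le_div_iff₀ (by positivity)] at h1
    have hpos : (0 : ℝ) < 2 * d ^ 2 := by positivity
    refine mac_smul hP (hmac i) ?_ ?_
    · rw [le_div_iff₀ (hμ i)]
      have := mul_le_mul_of_nonneg_right hai.1 hpos.le
      linarith
    · rw [div_le_one (hμ i)]
      have := mul_le_mul_of_nonneg_right hai.2 hpos.le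
      linarith

/-- dyadic half-widths -/
def hw (d : ℕ) (k : Fin d → ℕ) (i : Fin d) : ℝ := (1 / 2) ^ (k i + 1) / (2 * d ^ 2)

/-- dyadic box containing a piece of the flag simplex -/
def dbox (xs : Fin (d + 1) → Euc d) (k : Fin d → ℕ) : Set (Euc d) :=
  (fun z => z + -(xs 0 + ∑ i : Fin d, (3 / 4 * (1 / 2) ^ (k i) : ℝ) • (xs i.succ - xs i.castSucc))) ⁻¹'
    ((d ^ 2 : ℝ) • sbox (fun i => xs i.succ - xs i.castSucc) (hw d k))

lemma mem_dbox (hd : 1 ≤ d) (xs : Fin (d + 1) → Euc d) (k : Fin d → ℕ) {μ : Fin d → ℝ}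
    (h1 : ∀ i, (1 / 2 : ℝ) ^ (k i + 1) ≤ μ i) (h2 : ∀ i, μ i ≤ (1 / 2 : ℝ) ^ (k i)) :
    xs 0 + ∑ i : Fin d, μ i • (xs i.succ - xs i.castSucc) ∈ dbox xs k := by
  have hd0 : (0 : ℝ) < d := by exact_mod_cast hd
  refine ⟨∑ i : Fin d, ((μ i - 3 / 4 * (1 / 2) ^ (k i)) / d ^ 2) • (xs i.succ - xs i.castSucc),
    ⟨fun i => (μ i - 3 / 4 * (1 / 2) ^ (k i)) / d ^ 2, ?_, rfl⟩, ?_⟩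
  · intro i _
    have a1 := h1 i
    have a2 := h2 i
    rw [pow_succ] at a1
    have e : hw d k i = (1 / 4 * (1 / 2) ^ (k i)) / d ^ 2 := by
      unfold hw; rw [pow_succ]; field_simp; norm_num
    show (μ i - 3 / 4 * (1 / 2) ^ (k i)) / d ^ 2 ∈ Icc (-hw d k i) (hw d k i)
    rw [e, mem_Icc, ← neg_div]
    constructor
    · gcongr
      linarith
    · gcongr
      linarith
  · show (d ^ 2 : ℝ) • _ = _
    rw [Finset.smul_sum]
    have : ∀ i : Fin d, (d ^ 2 : ℝ) • (((μ i - 3 / 4 * (1 / 2) ^ (k i)) / d ^ 2) • (xs i.succ - xs i.castSucc))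
        = μ i • (xs i.succ - xs i.castSucc) - (3 / 4 * (1 / 2) ^ (k i) : ℝ) • (xs i.succ - xs i.castSucc) := by
      intro i
      rw [smul_smul, mul_div_cancel₀ _ (by positivity), sub_smul]
    simp_rw [this]
    rw [Finset.sum_sub_distrib]
    have key : ∀ A B x : Euc d, A - B = x + A + -(x + B) := by intros; abel
    exact key _ _ _

lemma dbox_volume (xs : Fin (d + 1) → Euc d) (k : Fin d → ℕ) :
    volume (dbox xs k) = ENNReal.ofReal ((4 * d ^ 2) ^ d) *
      volume ((1 / 4 : ℝ) • sbox (fun i => xs i.succ - xs i.castSucc) (hw d k)) := by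
  unfold dbox
  rw [measure_preimage_add_right, Measure.addHaar_smul, Measure.addHaar_smul, finrank_euclideanSpace_fin,
    ← mul_assoc, ← ENNReal.ofReal_mul (by positivity)]
  congr 2
  rw [abs_of_nonneg (by positivity), abs_of_nonneg (by positivity), ← mul_pow]
  congr 1
  ring

lemma dyadic {μ τ : ℝ} {L : ℕ} (h0 : (1 / 2 : ℝ) ^ (L + 1) < τ) (h1 : τ ≤ μ) (h2 : μ ≤ 1) :
    ∃ k < L + 1, (1 / 2 : ℝ) ^ (k + 1) ≤ μ ∧ μ ≤ (1 / 2 : ℝ) ^ k := by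
  have hμ : 0 < μ := lt_of_lt_of_le (lt_trans (by positivity) h0) h1
  obtain ⟨k, hk1, hk2⟩ := exists_nat_pow_near_of_lt_one hμ h2 (y := (1 / 2 : ℝ)) (by norm_num) (by norm_num)
  refine ⟨k, ?_, hk1.le, hk2⟩
  by_contra hcon
  have : (1 / 2 : ℝ) ^ k ≤ (1 / 2 : ℝ) ^ (L + 1) :=
    pow_le_pow_of_le_one (by norm_num) (by norm_num) (not_lt.1 hcon)
  linarith

end FlagEst


section ACore
variable {d : ℕ} {Ω : Set (Euc d)}

/-- piece of the deep region attached to a flag and a dyadic index -/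
def apiece (Ω P : Set (Euc d)) (ρ : ℝ) (xs : Fin (d + 1) → Euc d) (k : Fin d → ℕ) : Set (Euc d) :=
  ({x | ρ ≤ dep Ω x} ∩
    {x | sbox (fun i => xs i.succ - xs i.castSucc) (hw d k) ⊆ Mac P x}) ∩ dbox xs k

lemma sub_mac_closed {P : Set (Euc d)} (hP : IsClosed P) (S : Set (Euc d)) :
    IsClosed {x | S ⊆ Mac P x} := by
  have : {x | S ⊆ Mac P x} = ⋂ z ∈ S, ({x | x + z ∈ P} ∩ {x | x - z ∈ P}) := by
    ext x
    simp only [mem_ofPred_eq, mem_iInter, mem_inter_iff]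
    exact Iff.rfl
  rw [this]
  refine isClosed_biInter fun z _ => IsClosed.inter ?_ ?_
  · exact hP.preimage (continuous_id.add continuous_const)
  · exact hP.preimage (continuous_id.sub continuous_const)

lemma dbox_closed (xs : Fin (d + 1) → Euc d) (k : Fin d → ℕ) : IsClosed (dbox xs k) := by
  unfold dbox
  apply IsClosed.preimage (by fun_prop)
  exact ((sbox_compact _ _).smul _).isClosed

lemma apiece_measurable {P : Set (Euc d)} (hP : IsClosed P) (ρ : ℝ) (xs : Fin (d + 1) → Euc d)
    (k : Fin d → ℕ) : MeasurableSet (apiece Ω P ρ xs k) :=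
  ((dep_measurable ρ).inter (sub_mac_closed hP _).measurableSet).inter (dbox_closed xs k).measurableSet

lemma apiece_bound (hΩ : IsCompact Ω) (hΩn : Ω.Nonempty) (hΩc : Convex ℝ Ω) {P : Set (Euc d)}
    (hP : IsCompact P) (hPn : P.Nonempty) {ε ρ : ℝ} (h : hausdorffDist P Ω ≤ ε) (hρ : 0 < ρ)
    (hε : ε < ρ) (xs : Fin (d + 1) → Euc d) (k : Fin d → ℕ) :
    ∫⁻ x in apiece Ω P ρ xs k, bdens (interior Ω) x
      ≤ volume (ball (0 : Euc d) 1) * ENNReal.ofReal ((4 * d ^ 2) ^ d) := by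
  set S := sbox (fun i => xs i.succ - xs i.castSucc) (hw d k) with hS
  have hb : ∀ x ∈ apiece Ω P ρ xs k,
      bdens (interior Ω) x ≤ volume (ball (0 : Euc d) 1) / volume ((1 / 4 : ℝ) • S) := by
    intro x hx
    obtain ⟨⟨hx1, hx2⟩, hx3⟩ := hx
    have hx1 : ρ ≤ dep Ω x := hx1
    have hx2 : S ⊆ Mac P x := hx2
    refine (bdens_le hΩ hΩc (mem_interior_of_dep (hρ.trans_le hx1))).trans ?_
    gcongr
    have h1 := approx_mac hΩ hΩn hΩc hP hPn h hε ((ball_subset_ball hx1).trans (dep_ball x))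
    have e : (1 / 4 : ℝ) • S = (1 / 2 : ℝ) • ((1 / 2 : ℝ) • S) := by
      rw [smul_smul]; norm_num
    rw [e]
    exact smul_set_mono ((smul_set_mono hx2).trans h1)
  refine (setLIntegral_mono' (apiece_measurable hP.isClosed ρ xs k) hb).trans ?_
  rw [setLIntegral_const]
  have h2 : volume (apiece Ω P ρ xs k) ≤ ENNReal.ofReal ((4 * d ^ 2) ^ d) * volume ((1 / 4 : ℝ) • S) := by
    rw [← dbox_volume]
    exact measure_mono inter_subset_right
  have hfin : volume ((1 / 4 : ℝ) • S) ≠ ⊤ := ((sbox_compact _ _).smul _).measure_lt_top.ne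
  rcases eq_or_ne (volume ((1 / 4 : ℝ) • S)) 0 with h0 | h0
  · rw [h0, mul_zero, nonpos_iff_eq_zero] at h2
    rw [h2, mul_zero]
    exact bot_le
  · calc _ ≤ volume (ball (0 : Euc d) 1) / volume ((1 / 4 : ℝ) • S)
          * (ENNReal.ofReal ((4 * d ^ 2) ^ d) * volume ((1 / 4 : ℝ) • S)) := by gcongr
      _ = _ := by
        rw [div_eq_mul_inv, mul_comm (ENNReal.ofReal _), ← mul_assoc, mul_assoc (volume (ball (0 : Euc d) 1)),
          ENNReal.inv_mul_cancel h0 hfin, mul_one]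

lemma A_core (hd : 1 ≤ d) (hΩ : IsCompact Ω) (hΩn : Ω.Nonempty) (hΩc : Convex ℝ Ω)
    {V : Finset (Euc d)} (hV : V.Nonempty) (hdim : faceDim (convexHull ℝ (V : Set (Euc d))) = d)
    {ε ρ D : ℝ} (h : hausdorffDist (convexHull ℝ (V : Set (Euc d))) Ω ≤ ε) (hρ : 0 < ρ)
    (hε : ε < ρ / 2) (hD0 : 0 < D)
    (hD : ∀ x ∈ convexHull ℝ (V : Set (Euc d)), ∀ y ∈ convexHull ℝ (V : Set (Euc d)), dist x y ≤ D)
    {L : ℕ} (hL : (1 / 2 : ℝ) ^ (L + 1) < ρ / 2 / D) :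
    ∫⁻ x in {x | ρ ≤ dep Ω x}, bdens (interior Ω) x ≤
      ((flagSet d (convexHull ℝ (V : Set (Euc d)))).ncard * (L + 1) ^ d : ℕ) *
        (volume (ball (0 : Euc d) 1) * ENNReal.ofReal ((4 * d ^ 2) ^ d)) := by
  set P := convexHull ℝ (V : Set (Euc d)) with hP
  have hPn : P.Nonempty := by rw [hP, convexHull_nonempty_iff]; exact hV
  have hPk : IsCompact P := poly_compact V
  have hPc : Convex ℝ P := convex_convexHull ℝ _
  obtain ⟨N, hN, hcov⟩ := cover_flags hd hV
  have hfl : (flagSet d P).Finite := flags_finite V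
  have : Fintype (flagSet d P) := hfl.fintype
  let ι := (flagSet d P) × (Fin d → Fin (L + 1))
  let A : ι → Set (Euc d) := fun q =>
    apiece Ω P ρ (fun i => ctr (q.1.1 i)) (fun i => (q.2 i : ℕ))
  have hsub : {x | ρ ≤ dep Ω x} ⊆ N ∪ ⋃ q, A q := by
    intro x hx
    have hx' : ρ ≤ dep Ω x := hx
    have hb : ball x (ρ / 2) ⊆ P :=
      approx_ball hΩ hΩn hPk hPn hPc h hρ hε ((ball_subset_ball hx').trans (dep_ball x))
    rcases hcov x (hb (mem_ball_self (by linarith))) with hxN | ⟨f, hf, hxf⟩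
    · exact Or.inl hxN
    right
    obtain ⟨l, h0, hl, hxe⟩ := hull_range_weights _ hxf
    have hlast : ρ / 2 ≤ l (Fin.last d) * D := by
      rw [hxe] at hb
      exact flag_last hd hdim hf h0 hl hb hD
    have hτ : ∀ i, ρ / 2 / D ≤ tails l i := fun i => by
      refine le_trans ?_ (le_tails h0 i)
      rwa [div_le_iff₀ hD0]
    choose k hk1 hk2 hk3 using fun i => dyadic hL (hτ i) (tails_le h0 hl i)
    rw [mem_iUnion]
    refine ⟨(⟨f, hf⟩, fun i => ⟨k i, hk1 i⟩), ⟨hx, ?_⟩, ?_⟩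
    · have hpos : ∀ i, 0 < tails l i := fun i => lt_of_lt_of_le (by positivity) (hτ i)
      have := sbox_mac hd hPc (x := x) (s := hw d k) hpos
        (fun i => by rw [hxe]; exact flag_mac hd hf h0 hl i) (fun i => by
          unfold hw
          gcongr
          exact hk2 i)
      exact this
    · have := mem_dbox hd (fun i => ctr (f i)) k hk2 hk3
      rw [← abel_sum (fun i => ctr (f i)) l hl] at this
      rw [hxe]
      exact this
  calc ∫⁻ x in {x | ρ ≤ dep Ω x}, bdens (interior Ω) x
      ≤ ∫⁻ x in N ∪ ⋃ q, A q, bdens (interior Ω) x := lintegral_mono_set hsub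
    _ ≤ (∫⁻ x in N, bdens (interior Ω) x) + ∫⁻ x in ⋃ q, A q, bdens (interior Ω) x :=
        lintegral_union_le _ _ _
    _ = ∫⁻ x in ⋃ q, A q, bdens (interior Ω) x := by
        rw [setLIntegral_measure_zero N _ hN, zero_add]
    _ ≤ ∑' q, ∫⁻ x in A q, bdens (interior Ω) x := lintegral_iUnion_le _ _
    _ = ∑ q, ∫⁻ x in A q, bdens (interior Ω) x := tsum_fintype _
    _ ≤ Finset.card (Finset.univ : Finset ι) • (volume (ball (0 : Euc d) 1) * ENNReal.ofReal ((4 * d ^ 2) ^ d)) :=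
        Finset.sum_le_card_nsmul _ _ _ fun q _ =>
          apiece_bound hΩ hΩn hΩc hPk hPn h hρ (by linarith) _ _
    _ = _ := by
        rw [nsmul_eq_mul]
        congr 2
        rw [Finset.card_univ, Fintype.card_prod, Fintype.card_fun, Fintype.card_fin, Fintype.card_fin,
          Set.ncard_eq_toFinset_card', Set.toFinset_card]


lemma pow_small {L : ℕ} {R c : ℝ} (hR : 0 ≤ R) (hc : 0 ≤ c) (hL : 4 * R + 2 * c ≤ L) :
    (1 / 2 : ℝ) ^ (L + 1) < Real.exp (-2 * R) * Real.exp (-c) := by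
  have h2 : (1 / 2 : ℝ) = Real.exp (-Real.log 2) := by
    rw [Real.exp_neg, Real.exp_log (by norm_num)]; norm_num
  rw [h2, ← Real.exp_nat_mul, ← Real.exp_add, Real.exp_lt_exp]
  push_cast
  have := Real.log_two_gt_d9
  nlinarith

lemma A_final (hd : 1 ≤ d) (hΩ : IsCompact Ω) (hΩc : Convex ℝ Ω) {p : Euc d} {r : ℝ} (hr : 0 < r)
    (hp : ball p r ⊆ Ω) :
    ∃ C : ℝ, 0 < C ∧ ∀ R : ℝ, 0 ≤ R → ∀ V : Finset (Euc d), V.Nonempty →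
      faceDim (convexHull ℝ (V : Set (Euc d))) = d →
      hausdorffDist (convexHull ℝ (V : Set (Euc d))) Ω ≤ r / 4 * Real.exp (-2 * R) →
      (busemannVol (interior Ω) (hilbertBall (interior Ω) p R)).toReal
        ≤ C * (flagSet d (convexHull ℝ (V : Set (Euc d)))).ncard * (R + 1) ^ d := by
  have hΩn : Ω.Nonempty := ⟨p, hp (mem_ball_self hr)⟩
  obtain ⟨Λ, hΛ1, hΛ⟩ : ∃ Λ : ℝ, 0 < Λ ∧ Ω ⊆ closedBall p Λ := by
    obtain ⟨L, hL⟩ := hΩ.isBounded.subset_closedBall p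
    exact ⟨max L 1, by positivity, hL.trans (closedBall_subset_closedBall (le_max_left _ _))⟩
  have ho := om_pos d
  have hd0 : (0 : ℝ) < d := by exact_mod_cast hd
  set c := Real.log (4 * (Λ + r) / r) with hcdef
  have hc0 : 0 ≤ c := Real.log_nonneg (by rw [le_div_iff₀ hr]; linarith)
  refine ⟨(4 + 2 * c + 2) ^ d * (om d * (4 * d ^ 2) ^ d), by positivity, ?_⟩
  intro R hR V hV hdim hH
  set P := convexHull ℝ (V : Set (Euc d)) with hP
  have hPn : P.Nonempty := by rw [hP, convexHull_nonempty_iff]; exact hV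
  have hPk : IsCompact P := poly_compact V
  set L := ⌈4 * R + 2 * c⌉₊ with hLdef
  have hL1 : 4 * R + 2 * c ≤ L := Nat.le_ceil _
  have hL2 : (L : ℝ) < 4 * R + 2 * c + 1 := Nat.ceil_lt_add_one (by positivity)
  have hexp : Real.exp (-2 * R) ≤ 1 := Real.exp_le_one_iff.2 (by linarith)
  have hexp0 := Real.exp_pos (-2 * R)
  set ρ := Real.exp (-2 * R) * r with hρ
  have hρ0 : 0 < ρ := by positivity
  have hD : ∀ x ∈ P, ∀ y ∈ P, dist x y ≤ 2 * (Λ + r) := by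
    have key : ∀ x ∈ P, dist x p ≤ Λ + r := by
      intro x hx
      obtain ⟨y, hy, hxy⟩ := haus_left hΩ hΩn hPk hPn hH hx
      have h1 := mem_closedBall.1 (hΛ hy)
      have h2 := dist_triangle x y p
      nlinarith
    intro x hx y hy
    have h1 := key x hx
    have h2 := key y hy
    have h3 := dist_triangle_right x y p
    linarith
  have hLs : (1 / 2 : ℝ) ^ (L + 1) < ρ / 2 / (2 * (Λ + r)) := by
    refine lt_of_lt_of_eq (pow_small hR hc0 hL1) ?_
    rw [hcdef, Real.exp_neg, Real.exp_log (by positivity), hρ]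
    field_simp
    norm_num
  have hcore := A_core hd hΩ hΩn hΩc hV hdim hH hρ0 (by rw [hρ]; nlinarith) (by positivity) hD hLs
  have hsub : hilbertBall (interior Ω) p R ⊆ {x | ρ ≤ dep Ω x} := fun x hx =>
    le_dep hd hΩ (hilbert_deep hΩ hΩc hr hp hR hx)
  have hle : busemannVol (interior Ω) (hilbertBall (interior Ω) p R) ≤
      ENNReal.ofReal (((flagSet d P).ncard * (L + 1) ^ d : ℕ) * (om d * (4 * d ^ 2) ^ d)) := by
    refine le_trans (lintegral_mono_set hsub) (hcore.trans (le_of_eq ?_))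
    rw [ENNReal.ofReal_mul (by positivity), ENNReal.ofReal_mul ho.le, om_ofReal, ENNReal.ofReal_natCast]
  have h3 := ENNReal.toReal_le_of_le_ofReal (by positivity) hle
  refine h3.trans ?_
  push_cast
  have h4 : ((L : ℝ) + 1) ≤ (4 + 2 * c + 2) * (R + 1) := by nlinarith
  have h5 : ((L : ℝ) + 1) ^ d ≤ ((4 + 2 * c + 2) * (R + 1)) ^ d := by gcongr
  rw [mul_pow] at h5
  calc ((flagSet d P).ncard : ℝ) * ((L : ℝ) + 1) ^ d * (om d * (4 * d ^ 2) ^ d)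
      ≤ ((flagSet d P).ncard : ℝ) * ((4 + 2 * c + 2) ^ d * (R + 1) ^ d) * (om d * (4 * d ^ 2) ^ d) := by
        gcongr
    _ = _ := by ring

end ACore


section Final

lemma ev_bound_div {g : ℝ → ℝ} {a b : ℝ} (h : ∀ᶠ L in atTop, g L ≤ a + b * L) :
    ∀ᶠ L in atTop, g L / L ≤ |a| + b := by
  filter_upwards [h, eventually_ge_atTop 1] with L h1 h2
  rw [div_le_iff₀ (by linarith)]
  have := le_abs_self a
  have := abs_nonneg a
  nlinarith

lemma abstract_entropy (d : ℕ) {w G : ℝ → ℝ} {c1 c2 c5 c6 : ℝ}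
    (hG : ∀ L, 0 ≤ G L)
    (h1 : ∀ᶠ R in atTop, w R ≤ c1 + G (2 * R + c2) + d * Real.log (R + 1))
    (h2 : ∀ n : ℕ, 1 ≤ n → ∃ c3 c4 : ℝ, ∀ᶠ R in atTop, G (2 * (n / (n + d)) * R - c3) + c4 ≤ w R)
    (h3 : ∀ᶠ R in atTop, w R ≤ c5 + 2 * d * R)
    (h4 : ∀ᶠ R in atTop, c6 ≤ w R) :
    liminf (fun R => w R / R) atTop = 2 * liminf (fun L => G L / L) atTop := by
  have bE1 : IsBoundedUnder (· ≤ ·) atTop (fun R => w R / R) :=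
    ⟨_, eventually_map.2 (ev_bound_div h3)⟩
  have bE2 : IsBoundedUnder (· ≥ ·) atTop (fun R => w R / R) := by
    refine ⟨-|c6|, eventually_map.2 ?_⟩
    filter_upwards [h4, eventually_ge_atTop 1] with R h h'
    show -|c6| ≤ w R / R
    rw [le_div_iff₀ (by linarith)]
    have := neg_abs_le c6
    have := abs_nonneg c6
    nlinarith
  have bA2 : IsBoundedUnder (· ≥ ·) atTop (fun L => G L / L) := by
    refine ⟨0, eventually_map.2 ?_⟩
    filter_upwards [eventually_ge_atTop 1] with L h'
    exact div_nonneg (hG L) (by linarith)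
  have bA1 : IsBoundedUnder (· ≤ ·) atTop (fun L => G L / L) := by
    obtain ⟨c3, c4, h⟩ := h2 1 le_rfl
    set θ : ℝ := ((1 : ℕ) : ℝ) / ((1 : ℕ) + d) with hθ
    have hθ0 : 0 < θ := by rw [hθ]; positivity
    have ht : Tendsto (fun L : ℝ => (L + c3) / (2 * θ)) atTop atTop :=
      (tendsto_atTop_add_const_right _ _ tendsto_id).atTop_div_const (by positivity)
    have : ∀ᶠ L in atTop, G L ≤ (c5 - c4 + d / θ * c3) + d / θ * L := by
      filter_upwards [ht.eventually h, ht.eventually h3] with L a1 a2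
      have e1 : 2 * θ * ((L + c3) / (2 * θ)) - c3 = L := by field_simp; ring
      have e2 : 2 * d * ((L + c3) / (2 * θ)) = d / θ * L + d / θ * c3 := by field_simp
      rw [e1] at a1
      rw [e2] at a2
      linarith
    exact ⟨_, eventually_map.2 (ev_bound_div this)⟩
  apply le_antisymm
  · by_contra hcon
    push Not at hcon
    obtain ⟨x, hx1, hx2⟩ := exists_between hcon
    obtain ⟨y, hy1, hy2⟩ := exists_between hx1
    have hev := eventually_lt_of_lt_liminf hx2 bE2
    have hlog : ∀ᶠ R : ℝ in atTop, d * Real.log (R + 1) ≤ (x - y) / 2 * (R + 1) := by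
      have hl := (Real.isLittleO_log_id_atTop.const_mul_left (d : ℝ)).bound
        (show 0 < (x - y) / 2 by linarith)
      have hl2 := (tendsto_atTop_add_const_right atTop (1 : ℝ) tendsto_id).eventually hl
      filter_upwards [hl2, eventually_ge_atTop 0] with R a1 a2
      have a3 := (le_abs_self _).trans a1
      simp only [id, Real.norm_eq_abs] at a3
      rwa [abs_of_nonneg (by linarith : (0 : ℝ) ≤ R + 1)] at a3
    have hR : ∀ᶠ R in atTop, y / 2 * (2 * R + c2) ≤ G (2 * R + c2) := by
      filter_upwards [h1, hev, hlog, eventually_gt_atTop 0,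
        eventually_ge_atTop ((c1 + y / 2 * c2 + (x - y) / 2) / ((x - y) / 2))] with R a1 a2 a3 a4 a5
      rw [lt_div_iff₀ a4] at a2
      rw [div_le_iff₀ (by linarith)] at a5
      nlinarith
    have ht : Tendsto (fun L : ℝ => (L - c2) / 2) atTop atTop := by
      simp_rw [sub_eq_add_neg]
      exact (tendsto_atTop_add_const_right _ _ tendsto_id).atTop_div_const (by positivity)
    have : y / 2 ≤ liminf (fun L => G L / L) atTop := by
      apply le_liminf_of_le bA1.isCoboundedUnder_ge
      filter_upwards [ht.eventually hR, eventually_gt_atTop 0] with L a1 a2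
      have e1 : 2 * ((L - c2) / 2) + c2 = L := by ring
      rw [e1] at a1
      rwa [le_div_iff₀ a2]
    linarith
  · by_contra hcon
    push Not at hcon
    have hcon' : liminf (fun R => w R / R) atTop / 2 < liminf (fun L => G L / L) atTop := by linarith
    obtain ⟨x, hx1, hx2⟩ := exists_between hcon'
    obtain ⟨y, hy1, hy2⟩ := exists_between hx1
    have hev := eventually_lt_of_lt_liminf hx2 bA2
    obtain ⟨n, hn1, hn⟩ : ∃ n : ℕ, 1 ≤ n ∧ y < x * (n / (n + d)) := by
      have ht : Tendsto (fun n : ℕ => x * ((n : ℝ) / (n + d))) atTop (𝓝 (x * 1)) :=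
        (tendsto_natCast_div_add_atTop (d : ℝ)).const_mul x
      rw [mul_one] at ht
      exact ((eventually_ge_atTop 1).and (ht.eventually (lt_mem_nhds hy2))).exists
    obtain ⟨c3, c4, h⟩ := h2 n hn1
    have hn0 : (0 : ℝ) < n := by exact_mod_cast hn1
    set θ : ℝ := (n : ℝ) / (n + d) with hθ
    have hθ0 : 0 < θ := by positivity
    have ht : Tendsto (fun R : ℝ => 2 * θ * R - c3) atTop atTop := by
      simp_rw [sub_eq_add_neg]
      exact tendsto_atTop_add_const_right _ _ (tendsto_id.const_mul_atTop (by positivity))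
    have : 2 * y ≤ liminf (fun R => w R / R) atTop := by
      apply le_liminf_of_le bE1.isCoboundedUnder_ge
      filter_upwards [h, ht.eventually hev, ht.eventually (eventually_gt_atTop 0), eventually_gt_atTop 0,
        eventually_ge_atTop ((c3 * x - c4) / (2 * (x * θ - y)))] with R a1 a2 a3 a4 a5
      rw [lt_div_iff₀ a3] at a2
      rw [div_le_iff₀ (by linarith)] at a5
      rw [le_div_iff₀ a4]
      nlinarith
    linarith

lemma flagApprox_eq (d : ℕ) (Ω : Set (Euc d)) :
    flagApprox d Ω = liminf (fun L : ℝ => Real.log (flagNumber d Ω (Real.exp (-L))) / L) atTop := by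
  unfold flagApprox
  have h : 𝓝[>] (0 : ℝ) = map (fun L : ℝ => Real.exp (-L)) atTop := by
    rw [← Real.map_exp_atBot, ← map_neg_atTop, map_map]
    rfl
  rw [h]
  show liminf ((fun ε : ℝ => Real.log (flagNumber d Ω ε) / (- Real.log ε)) ∘ fun L : ℝ => Real.exp (-L)) atTop = _
  congr 1
  funext L
  simp

lemma flagNumber_le {d : ℕ} {Ω : Set (Euc d)} {ε : ℝ} {V : Finset (Euc d)} (hV : V.Nonempty)
    (hdim : faceDim (convexHull ℝ (V : Set (Euc d))) = d)
    (h : hausdorffDist (convexHull ℝ (V : Set (Euc d))) Ω ≤ ε) :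
    flagNumber d Ω ε ≤ (flagSet d (convexHull ℝ (V : Set (Euc d)))).ncard :=
  Nat.sInf_le ⟨V, hV, hdim, h, rfl⟩

lemma flagNumber_attained {d : ℕ} (hd : 1 ≤ d) {Ω : Set (Euc d)} (hcomp : IsCompact Ω) (hc : Convex ℝ Ω)
    {p : Euc d} (hp : p ∈ interior Ω) {ε : ℝ} (hε : 0 < ε) :
    ∃ V : Finset (Euc d), V.Nonempty ∧
    faceDim (convexHull ℝ (V : Set (Euc d))) = d ∧
    Metric.hausdorffDist (convexHull ℝ (V : Set (Euc d))) Ω ≤ ε ∧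
    (flagSet d (convexHull ℝ (V : Set (Euc d)))).ncard = flagNumber d Ω ε := by
  refine Nat.sInf_mem (s := {n | ∃ V : Finset (Euc d), V.Nonempty ∧
    faceDim (convexHull ℝ (V : Set (Euc d))) = d ∧
    Metric.hausdorffDist (convexHull ℝ (V : Set (Euc d))) Ω ≤ ε ∧
    (flagSet d (convexHull ℝ (V : Set (Euc d)))).ncard = n}) ?_
  obtain ⟨C, κ, hC, hκ, hev⟩ := B_final hd hcomp hc hp (n := 1) le_rfl
  have hd0 : (0 : ℝ) < d := by exact_mod_cast hd
  set θ : ℝ := ((1 : ℕ) : ℝ) / ((1 : ℕ) + d) with hθ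
  have hθ0 : 0 < θ := by positivity
  have ht : Tendsto (fun R : ℝ => C * Real.exp (-2 * R * θ)) atTop (𝓝 (C * 0)) := by
    apply Tendsto.const_mul
    apply Real.tendsto_exp_atBot.comp
    have : (fun R : ℝ => -2 * R * θ) = fun R => (-2 * θ) * R := by funext R; ring
    rw [this]
    exact tendsto_id.const_mul_atTop_of_neg (by linarith)
  rw [mul_zero] at ht
  obtain ⟨R, ⟨V, hV1, hV2, hV3, -⟩, hR⟩ := (hev.and (ht.eventually (gt_mem_nhds hε))).exists
  exact ⟨_, V, hV1, hV2, hV3.trans hR.le, rfl⟩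

lemma main_aux {d : ℕ} (hd : 1 ≤ d) {Ω : Set (Euc d)} (hcomp : IsCompact Ω) (hc : Convex ℝ Ω)
    {p : Euc d} (hp : p ∈ interior Ω) :
    liminf (fun R : ℝ =>
          Real.log ((busemannVol (interior Ω) (hilbertBall (interior Ω) p R)).toReal) / R) atTop
      = 2 * flagApprox d Ω := by
  rw [flagApprox_eq]
  obtain ⟨r, hr, hpr⟩ := Metric.isOpen_iff.1 isOpen_interior p hp
  have hpr := hpr.trans interior_subset
  obtain ⟨C, hC, hA⟩ := A_final hd hcomp hc hr hpr
  obtain ⟨_, κ, _, hκ, hev⟩ := B_final hd hcomp hc hp (n := 1) le_rfl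
  have hpos : ∀ᶠ R : ℝ in atTop,
      κ ≤ (busemannVol (interior Ω) (hilbertBall (interior Ω) p R)).toReal := by
    filter_upwards [hev] with R hR
    obtain ⟨V, _, _, _, h, _⟩ := hR
    exact h
  have hΩv : 0 < (volume Ω).toReal := by
    apply ENNReal.toReal_pos _ hcomp.measure_lt_top.ne
    exact (lt_of_lt_of_le (measure_ball_pos _ p hr) (measure_mono hpr)).ne'
  have hNpos : ∀ᶠ R : ℝ in atTop, 0 < flagNumber d Ω (r / 4 * Real.exp (-2 * R)) ∧
      (busemannVol (interior Ω) (hilbertBall (interior Ω) p R)).toReal ≤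
        C * flagNumber d Ω (r / 4 * Real.exp (-2 * R)) * (R + 1) ^ d := by
    filter_upwards [hpos, eventually_ge_atTop 0] with R a1 a2
    obtain ⟨V, hV1, hV2, hV3, hV4⟩ := flagNumber_attained hd hcomp hc hp
      (ε := r / 4 * Real.exp (-2 * R)) (by positivity)
    have h := hA R a2 V hV1 hV2 hV3
    rw [hV4] at h
    refine ⟨?_, h⟩
    rw [Nat.pos_iff_ne_zero]
    intro h0
    rw [h0] at h
    simp only [Nat.cast_zero, mul_zero, zero_mul] at h
    linarith
  apply abstract_entropy d (c1 := Real.log C) (c2 := -Real.log (r / 4))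
    (c5 := Real.log (2 ^ d / r ^ d * (volume Ω).toReal)) (c6 := Real.log κ)
  · intro L
    exact Real.log_natCast_nonneg _
  · filter_upwards [hpos, hNpos, eventually_ge_atTop 0] with R a1 a2 a3
    have e : Real.exp (-(2 * R + -Real.log (r / 4))) = r / 4 * Real.exp (-2 * R) := by
      rw [neg_add, neg_neg, Real.exp_add, Real.exp_log (by positivity), mul_comm]
      congr 2
      ring
    rw [e]
    have hN : (0 : ℝ) < flagNumber d Ω (r / 4 * Real.exp (-2 * R)) := by exact_mod_cast a2.1
    have := Real.log_le_log (lt_of_lt_of_le hκ a1) a2.2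
    rwa [Real.log_mul (by positivity) (by positivity), Real.log_mul (by positivity) (by positivity),
      Real.log_pow] at this
  · intro n hn
    obtain ⟨C', κ', hC', hκ', hev'⟩ := B_final hd hcomp hc hp hn
    have hn0 : (0 : ℝ) < n := by exact_mod_cast hn
    set θ : ℝ := (n : ℝ) / (n + d) with hθ
    have hθ0 : 0 < θ := by positivity
    refine ⟨Real.log C', Real.log κ', ?_⟩
    have ht : Tendsto (fun R : ℝ => (2 * θ * R - Real.log C' - Real.log (r / 4)⁻¹) / 2) atTop atTop := by
      simp_rw [sub_eq_add_neg]
      exact (tendsto_atTop_add_const_right _ _ (tendsto_atTop_add_const_right _ _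
        (tendsto_id.const_mul_atTop (by positivity)))).atTop_div_const (by norm_num)
    filter_upwards [hev', ht.eventually hNpos] with R a1 a2
    obtain ⟨V, hV1, hV2, hV3, hV4, hV5⟩ := a1
    have e0 : Real.exp (-(2 * θ * R - Real.log C')) = C' * Real.exp (-2 * R * θ) := by
      rw [neg_sub, sub_eq_add_neg, Real.exp_add, Real.exp_log hC']
      congr 2
      ring
    have e1 : r / 4 * Real.exp (-2 * ((2 * θ * R - Real.log C' - Real.log (r / 4)⁻¹) / 2))
        = C' * Real.exp (-2 * R * θ) := by
      have : -2 * ((2 * θ * R - Real.log C' - Real.log (r / 4)⁻¹) / 2)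
          = -2 * R * θ + Real.log C' + Real.log (r / 4)⁻¹ := by ring
      rw [this, Real.exp_add, Real.exp_add, Real.exp_log hC', Real.exp_log (by positivity)]
      field_simp
    rw [e1] at a2
    rw [e0]
    have hN : (0 : ℝ) < flagNumber d Ω (C' * Real.exp (-2 * R * θ)) := by exact_mod_cast a2.1
    have hle : (flagNumber d Ω (C' * Real.exp (-2 * R * θ)) : ℝ) ≤
        (flagSet d (convexHull ℝ (V : Set (Euc d)))).ncard := by
      exact_mod_cast flagNumber_le hV1 hV2 hV3
    rw [add_comm, ← Real.log_mul hκ'.ne' hN.ne']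
    apply Real.log_le_log (by positivity)
    refine le_trans ?_ hV5
    gcongr
  · filter_upwards [hpos, eventually_ge_atTop 0] with R a1 a2
    have h := ENNReal.toReal_le_of_le_ofReal (by positivity) (vol_crude hd hcomp hc hr hpr a2)
    have := Real.log_le_log (lt_of_lt_of_le hκ a1) h
    refine this.trans (le_of_eq ?_)
    have e : (2 : ℝ) ^ d / (Real.exp (-2 * R) * r) ^ d * (volume Ω).toReal
        = (2 ^ d / r ^ d * (volume Ω).toReal) * Real.exp (2 * d * R) := by
      have : (Real.exp (-2 * R)) ^ d = (Real.exp (2 * d * R))⁻¹ := by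
        rw [← Real.exp_nat_mul, ← Real.exp_neg]; congr 1; ring
      rw [mul_pow, this]
      field_simp
    rw [e, Real.log_mul (by positivity) (by positivity), Real.log_exp]
  · filter_upwards [hpos] with R a1
    exact Real.log_le_log hκ a1

end Final


/-- For a convex body `Ω ⊆ ℝ^d` (`d ≥ 1`) and any base point `p ∈ int Ω`,
the volume entropy of the Hilbert geometry on `Ω` equals twice the flag approximability. -/
theorem entropy_eq_two_mul_flagApprox (d : ℕ) (hd : 1 ≤ d) (Ω : Set (Euc d))
    (hcomp : IsCompact Ω) (hconv : Convex ℝ Ω) (hint : (interior Ω).Nonempty) :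
    ∀ p ∈ interior Ω,
      liminf (fun R : ℝ =>
          Real.log ((busemannVol (interior Ω) (hilbertBall (interior Ω) p R)).toReal) / R)
        atTop
      = 2 * flagApprox d Ω := by
  intro p hp
  exact main_aux hd hcomp hconv hp

end
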